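/- arXiv:2207.00270 — 13 statements merged into one kernel-verified Lean document; each statement's English description precedes it below -/
import Mathlib

section
/- For all integers 1 ≤ k ≤ n ≤ N and every positive integer r, the r-th rising factorial moment of the FPOS distribution satisfies Σ_{x=k}^{N−n+k} x^{(r)} · f(x; k, n, N) = (N+1)^{(r)} · k^{(r)} / (n+1)^{(r)}, where a^{(r)} = a(a+1)···(a+r−1) denotes the rising factorial. -/
/-- The FPOS probability mass function: f(x; k, n, N) = C(x−1, k−1)·C(N−x, n−k) / C(N, n). -/
noncomputable def fpos (k n N x : ℕ) : ℝ :=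
  (((x - 1).choose (k - 1) * (N - x).choose (n - k) : ℕ) : ℝ) / (N.choose n : ℝ)

/-- The rising factorial a^{(r)} = a(a+1)⋯(a+r−1) for a real number a. -/
noncomputable def risingFactorial (a : ℝ) (r : ℕ) : ℝ :=
  ∏ i ∈ Finset.range r, (a + i)

lemma aux_vander (a b M : ℕ) :
    ∑ p ∈ Finset.HasAntidiagonal.antidiagonal M, (a + p.1).choose a * (b + p.2).choose b
      = (a + b + 1 + M).choose (a + b + 1) := by
  have h := PowerSeries.invOneSubPow_add (S := ℤ) (a + 1) (b + 1)
  have h2 := congrArg (fun u : (PowerSeries ℤ)ˣ => PowerSeries.coeff M u.val) h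
  have e : a + 1 + (b + 1) = (a + b + 1) + 1 := by ring
  rw [e] at h2
  simp only [Units.val_mul, PowerSeries.invOneSubPow_val_succ_eq_mk_add_choose,
    PowerSeries.coeff_mul, PowerSeries.coeff_mk] at h2
  exact_mod_cast h2.symm

lemma aux_rf (a r : ℕ) : risingFactorial ((a : ℝ) + 1) r = ((a + 1).ascFactorial r : ℝ) := by
  rw [Nat.ascFactorial_eq_prod_range, risingFactorial]
  push_cast
  rfl

lemma aux_abs (a j r : ℕ) : (a + j + 1).ascFactorial r * (a + j).choose a
    = (a + 1).ascFactorial r * (a + r + j).choose (a + r) := by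
  have h1 := Nat.factorial_mul_ascFactorial (a + j) r
  have h2 := Nat.factorial_mul_ascFactorial a r
  have h3 := Nat.add_choose_mul_factorial_mul_factorial a j
  have h4 := Nat.add_choose_mul_factorial_mul_factorial (a + r) j
  rw [show a + j + r = a + r + j by ring] at h1
  rw [← Nat.choose_symm_add] at h3 h4
  have hp : 0 < a.factorial * j.factorial := by positivity
  apply Nat.eq_of_mul_eq_mul_right hp
  rw [← h2] at h4
  calc _ = ((a + j).choose a * a.factorial * j.factorial) * (a + j + 1).ascFactorial r := by ring
    _ = (a + r + j).factorial := by rw [h3, h1]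
    _ = _ := by rw [← h4]; ring

/-- For all integers 1 ≤ k ≤ n ≤ N and every positive integer r, the r-th
rising factorial moment of the FPOS distribution satisfies
Σ_{x=k}^{N−n+k} x^{(r)} · f(x; k, n, N) = (N+1)^{(r)} · k^{(r)} / (n+1)^{(r)}. -/
theorem fpos_rising_factorial_moment (k n N r : ℕ) (hk : 1 ≤ k) (hkn : k ≤ n) (hnN : n ≤ N)
    (hr : 1 ≤ r) :
    ∑ x ∈ Finset.Icc k (N - n + k), risingFactorial (x : ℝ) r * fpos k n N x =
      risingFactorial ((N : ℝ) + 1) r * risingFactorial (k : ℝ) r /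
        risingFactorial ((n : ℝ) + 1) r := by
  obtain ⟨a, rfl⟩ := Nat.exists_eq_add_of_le' hk
  obtain ⟨b, rfl⟩ := Nat.exists_eq_add_of_le hkn
  obtain ⟨M, rfl⟩ := Nat.exists_eq_add_of_le hnN
  have hI : Finset.Icc (a + 1) (a + 1 + b + M - (a + 1 + b) + (a + 1))
      = (Finset.range (M + 1)).image (fun j => a + 1 + j) := by
    ext x
    simp only [Finset.mem_Icc, Finset.mem_image, Finset.mem_range]
    constructor
    · intro h
      exact ⟨x - (a + 1), by omega, by omega⟩
    · rintro ⟨j, hj, rfl⟩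
      omega
  rw [hI, Finset.sum_image (by intro x _ y _ h; simpa using h)]
  have hterm : ∀ j ∈ Finset.range (M + 1),
      risingFactorial ((a + 1 + j : ℕ) : ℝ) r * fpos (a + 1) (a + 1 + b) (a + 1 + b + M) (a + 1 + j)
      = ((a + 1).ascFactorial r : ℝ) / ((a + 1 + b + M).choose (a + 1 + b) : ℝ) *
        (((a + r + j).choose (a + r) * (b + (M - j)).choose b : ℕ) : ℝ) := by
    intro j hj
    have hj' := Finset.mem_range.mp hj
    have e1 : ((a + 1 + j : ℕ) : ℝ) = ((a + j : ℕ) : ℝ) + 1 := by push_cast; ring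
    rw [e1, aux_rf, fpos, show a + 1 + j - 1 = a + j by omega, show a + 1 - 1 = a by omega,
      show a + 1 + b + M - (a + 1 + j) = b + (M - j) by omega,
      show a + 1 + b - (a + 1) = b by omega]
    have h : ((a + j + 1).ascFactorial r : ℝ) * ((a + j).choose a : ℝ)
        = ((a + 1).ascFactorial r : ℝ) * ((a + r + j).choose (a + r) : ℝ) := by
      exact_mod_cast aux_abs a j r
    rw [Nat.cast_mul, Nat.cast_mul, mul_div_assoc', ← mul_assoc, h]
    ring
  rw [Finset.sum_congr rfl hterm, ← Finset.mul_sum, ← Nat.cast_sum,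
    ← Finset.Nat.sum_antidiagonal_eq_sum_range_succ
      (fun i j => (a + r + i).choose (a + r) * (b + j).choose b) M, aux_vander]
  have h : ((a + 1 + b + M + 1).ascFactorial r : ℝ) * ((a + 1 + b + M).choose (a + 1 + b) : ℝ)
      = ((a + 1 + b + 1).ascFactorial r : ℝ)
        * ((a + 1 + b + r + M).choose (a + 1 + b + r) : ℝ) := by
    exact_mod_cast aux_abs (a + 1 + b) M r
  rw [aux_rf, aux_rf, show a + r + b + 1 = a + 1 + b + r by ring, Nat.cast_succ a, aux_rf]
  have p1 : ((a + 1 + b + 1).ascFactorial r : ℝ) ≠ 0 := by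
    exact_mod_cast (Nat.ascFactorial_pos _ _).ne'
  have p2 : ((a + 1 + b + M).choose (a + 1 + b) : ℝ) ≠ 0 := by
    exact_mod_cast (Nat.choose_pos (by omega)).ne'
  rw [div_mul_eq_mul_div, div_eq_div_iff p2 p1]
  linear_combination (-((a + 1).ascFactorial r : ℝ)) * h
end

section
/- For all integers 1 ≤ k ≤ n ≤ N, the mean of the FPOS distribution satisfies Σ_{x=k}^{N−n+k} x · f(x; k, n, N) = k(N+1)/(n+1). -/
theorem fpos_aux (a b m : ℕ) :
    ∑ p ∈ Finset.HasAntidiagonal.antidiagonal m, (a + p.1).choose a * (b + p.2).choose b =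
      (a + b + 1 + m).choose (a + b + 1) := by
  have h : (PowerSeries.mk (1 : ℕ → ℤ)) ^ (a + 1) * (PowerSeries.mk (1 : ℕ → ℤ)) ^ (b + 1)
      = (PowerSeries.mk (1 : ℕ → ℤ)) ^ ((a + b + 1) + 1) := by
    rw [← pow_add]; congr 1; ring
  rw [PowerSeries.mk_one_pow_eq_mk_choose_add, PowerSeries.mk_one_pow_eq_mk_choose_add,
    PowerSeries.mk_one_pow_eq_mk_choose_add] at h
  have h2 := congrArg (PowerSeries.coeff m) h
  rw [PowerSeries.coeff_mul] at h2
  simp only [PowerSeries.coeff_mk] at h2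
  exact_mod_cast h2

theorem fpos_mean (k n N : ℕ) (hk : 1 ≤ k) (hkn : k ≤ n) (hnN : n ≤ N) :
    ∑ x ∈ Finset.Icc k (N - n + k), (x : ℝ) * fpos k n N x =
      (k : ℝ) * ((N : ℝ) + 1) / ((n : ℝ) + 1) := by
  obtain ⟨m, rfl⟩ := Nat.exists_eq_add_of_le hnN
  obtain ⟨b, rfl⟩ := Nat.exists_eq_add_of_le hkn
  obtain ⟨c, rfl⟩ : ∃ c, k = c + 1 := ⟨k - 1, by omega⟩
  have h1 : ∑ x ∈ Finset.Icc (c + 1) (c + 1 + b + m - (c + 1 + b) + (c + 1)),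
      x * ((x - 1).choose (c + 1 - 1) * (c + 1 + b + m - x).choose (c + 1 + b - (c + 1)))
      = (c + 1) * (c + 1 + b + 1 + m).choose (c + 1 + b + 1) := by
    rw [← fpos_aux, Finset.mul_sum, Finset.Nat.sum_antidiagonal_eq_sum_range_succ_mk]
    rw [← Finset.Ico_add_one_right_eq_Icc, Finset.sum_Ico_eq_sum_range]
    have e : c + 1 + b + m - (c + 1 + b) + (c + 1) + 1 - (c + 1) = m.succ := by omega
    rw [e]
    refine Finset.sum_congr rfl fun i hi => ?_
    have hi' : i < m + 1 := Finset.mem_range.mp hi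
    have e1 : c + 1 + i - 1 = c + i := by omega
    have e2 : c + 1 + b + m - (c + 1 + i) = b + (m - i) := by omega
    have e3 : c + 1 + b - (c + 1) = b := by omega
    have e4 : c + 1 + i = c + i + 1 := by omega
    rw [e1, e2, e3, Nat.add_sub_cancel]
    simp only [e4]
    have := Nat.add_one_mul_choose_eq (c + i) c
    rw [← mul_assoc, this]; ring
  have h2 := Nat.add_one_mul_choose_eq (c + 1 + b + m) (c + 1 + b)
  have e5 : c + 1 + b + m + 1 = c + 1 + b + 1 + m := by omega
  have hpos : (((c + 1 + b + m).choose (c + 1 + b) : ℕ) : ℝ) ≠ 0 := by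
    exact_mod_cast (Nat.choose_pos hnN).ne'
  have hn : ((c + 1 + b : ℕ) : ℝ) + 1 ≠ 0 := by positivity
  unfold fpos
  simp only [← mul_div_assoc]
  rw [← Finset.sum_div, div_eq_div_iff hpos hn]
  have h1' := congrArg (Nat.cast : ℕ → ℝ) h1
  rw [Nat.cast_sum] at h1'
  simp only [Nat.cast_mul] at h1' ⊢
  rw [h1', ← e5]
  have h2' := congrArg (Nat.cast : ℕ → ℝ) h2
  push_cast at h2' ⊢
  linear_combination (-(c : ℝ) - 1) * h2'
end

section
/- For all integers 1 ≤ k ≤ n ≤ N, the variance of the FPOS distribution satisfies Σ_{x=k}^{N−n+k} (x − μ)² · f(x; k, n, N) = (N+1)(N−n)·k(n−k+1) / ((n+1)²(n+2)), where μ = k(N+1)/(n+1). -/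
lemma conv_choose (a b M : ℕ) :
    ∑ i ∈ Finset.range (M + 1), (((a + i).choose a : ℝ) * ((b + (M - i)).choose b : ℝ)) =
      ((a + b + 1 + M).choose (a + b + 1) : ℝ) := by
  have h : ((PowerSeries.mk 1 : PowerSeries ℝ) ^ (a + 1)) * (PowerSeries.mk 1) ^ (b + 1) =
      (PowerSeries.mk 1) ^ (a + b + 1 + 1) := by
    rw [← pow_add]; congr 1; omega
  rw [PowerSeries.mk_one_pow_eq_mk_choose_add, PowerSeries.mk_one_pow_eq_mk_choose_add,
    PowerSeries.mk_one_pow_eq_mk_choose_add] at h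
  have h2 := congrArg (PowerSeries.coeff M) h
  rw [PowerSeries.coeff_mul, Finset.Nat.sum_antidiagonal_eq_sum_range_succ_mk] at h2
  simpa using h2

lemma absorb (a i : ℕ) : ((i : ℝ) + a + 1) * ((a + i).choose a : ℝ) =
    (a + 1) * ((a + 1 + i).choose (a + 1) : ℝ) := by
  have h := Nat.add_one_mul_choose_eq (a + i) a
  have h' : a + 1 + i = a + i + 1 := by omega
  rw [h']
  have h2 : (((a + i + 1) * (a + i).choose a : ℕ) : ℝ) =
    (((a + i + 1).choose (a + 1) * (a + 1) : ℕ) : ℝ) := by rw [h]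
  push_cast at h2
  linarith

/-- For all integers 1 ≤ k ≤ n ≤ N, the variance of the FPOS distribution
satisfies Σ_{x=k}^{N−n+k} (x − μ)² · f(x; k, n, N) = (N+1)(N−n)·k(n−k+1) / ((n+1)²(n+2)),
where μ = k(N+1)/(n+1). -/
theorem fpos_variance (k n N : ℕ) (hk : 1 ≤ k) (hkn : k ≤ n) (hnN : n ≤ N) :
    ∑ x ∈ Finset.Icc k (N - n + k),
        ((x : ℝ) - (k : ℝ) * ((N : ℝ) + 1) / ((n : ℝ) + 1)) ^ 2 * fpos k n N x =
      ((N : ℝ) + 1) * ((N : ℝ) - (n : ℝ)) * (k : ℝ) * ((n : ℝ) - (k : ℝ) + 1) /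
        (((n : ℝ) + 1) ^ 2 * ((n : ℝ) + 2)) := by
  obtain ⟨a, rfl⟩ : ∃ a, k = a + 1 := ⟨k - 1, by omega⟩
  obtain ⟨b, rfl⟩ : ∃ b, n = a + 1 + b := ⟨n - (a + 1), by omega⟩
  obtain ⟨M, rfl⟩ : ∃ M, N = a + 1 + b + M := ⟨N - (a + 1 + b), by omega⟩
  have hI : Finset.Icc (a + 1) (a + 1 + b + M - (a + 1 + b) + (a + 1)) =
      Finset.Ico (a + 1) (a + 1 + (M + 1)) := by
    ext x; simp only [Finset.mem_Icc, Finset.mem_Ico]; omega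
  rw [hI, Finset.sum_Ico_eq_sum_range]
  have hr : a + 1 + (M + 1) - (a + 1) = M + 1 := by omega
  rw [hr]
  set C : ℝ := ((a + 1 + b + M).choose (a + 1 + b) : ℝ) with hC
  have hCpos : 0 < C := by
    rw [hC]; exact_mod_cast Nat.choose_pos (by omega)
  set m : ℝ := ((a + 1 : ℕ) : ℝ) * (((a + 1 + b + M : ℕ) : ℝ) + 1) / (((a + 1 + b : ℕ) : ℝ) + 1)
    with hm
  have hterm : ∀ i ∈ Finset.range (M + 1),
      (((a + 1 + i : ℕ) : ℝ) - m) ^ 2 * fpos (a + 1) (a + 1 + b) (a + 1 + b + M) (a + 1 + i) =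
      ((a + 1) * (a + 2) * (((a + 2 + i).choose (a + 2) : ℝ) * ((b + (M - i)).choose b : ℝ))
       - (1 + 2 * m) * (a + 1) * (((a + 1 + i).choose (a + 1) : ℝ) * ((b + (M - i)).choose b : ℝ))
       + m ^ 2 * (((a + i).choose a : ℝ) * ((b + (M - i)).choose b : ℝ))) / C := by
    intro i hi
    have hi' : i < M + 1 := Finset.mem_range.mp hi
    unfold fpos
    have e1 : a + 1 + i - 1 = a + i := by omega
    have e2 : a + 1 - 1 = a := by omega
    have e3 : a + 1 + b + M - (a + 1 + i) = b + (M - i) := by omega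
    have e4 : a + 1 + b - (a + 1) = b := by omega
    rw [e1, e2, e3, e4, ← hC, mul_div_assoc']
    congr 1
    have h1 := absorb a i
    have h2 := absorb (a + 1) i
    rw [show a + 1 + 1 = a + 2 from rfl] at h2
    push_cast at h2 ⊢
    generalize ((b + (M - i)).choose b : ℝ) = Q at *
    generalize ((a + i).choose a : ℝ) = P at *
    generalize ((a + 1 + i).choose (a + 1) : ℝ) = P1 at *
    generalize ((a + 2 + i).choose (a + 2) : ℝ) = P2 at *
    linear_combination ((a:ℝ) + 1) * Q * h2 + (i + a + 2 - (1 + 2 * m)) * Q * h1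
  rw [Finset.sum_congr rfl hterm, ← Finset.sum_div, Finset.sum_add_distrib,
    Finset.sum_sub_distrib, ← Finset.mul_sum, ← Finset.mul_sum, ← Finset.mul_sum,
    conv_choose, conv_choose, conv_choose]
  have g1 := absorb (a + 1 + b) M
  have g2 := absorb (a + 1 + b + 1) M
  rw [← hC] at g1
  rw [show a + b + 1 = a + 1 + b by omega, show a + 1 + b + 1 = a + 1 + b + 1 from rfl,
    show a + 2 + b + 1 = a + 1 + b + 1 + 1 by omega, ← hC]
  generalize ((a + 1 + b + 1 + M).choose (a + 1 + b + 1) : ℝ) = C1 at *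
  generalize ((a + 1 + b + 1 + 1 + M).choose (a + 1 + b + 1 + 1) : ℝ) = C2 at *
  clear_value C
  push_cast at g1 g2 hm ⊢
  have p1 : (0:ℝ) < a + 1 + b + 1 := by positivity
  have p2 : (0:ℝ) < a + 1 + b + 1 + 1 := by positivity
  have q1 : C1 = (M + (a + 1 + b) + 1) * C / (a + 1 + b + 1) := by
    rw [eq_div_iff p1.ne']; linarith
  have q2 : C2 = (M + (a + 1 + b + 1) + 1) * C1 / (a + 1 + b + 1 + 1) := by
    rw [eq_div_iff p2.ne']; linarith
  have p3 : (0:ℝ) < a + 1 + b + 2 := by positivity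
  rw [q2, q1, hm]
  rw [show (a:ℝ) + 1 + b + 1 + 1 = a + 1 + b + 2 by ring]
  field_simp
  ring
end

section
/- For all integers 1 ≤ k ≤ n < N, the skewness of the FPOS distribution satisfies (Σ_{x=k}^{N−n+k} (x − μ)³ · f(x; k, n, N)) / σ³ = (n − 2k + 1)·(1 + 2(N − n − 1)/(n + 3))·√( (n+2) / ((N+1)(N−n)k(n−k+1)) ), where μ = k(N+1)/(n+1) and σ² = (N+1)(N−n)k(n−k+1)/((n+1)²(n+2)). -/
/-- The mean of the FPOS distribution: μ(k, n, N) = k(N+1)/(n+1). -/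
noncomputable def fposMean (k n N : ℕ) : ℝ := (k : ℝ) * ((N : ℝ) + 1) / ((n : ℝ) + 1)

/-- The variance of the FPOS distribution:
σ²(k, n, N) = (N+1)(N−n)k(n−k+1)/((n+1)²(n+2)). -/
noncomputable def fposVar (k n N : ℕ) : ℝ :=
  ((N : ℝ) + 1) * ((N : ℝ) - (n : ℝ)) * (k : ℝ) * ((n : ℝ) - (k : ℝ) + 1) /
    (((n : ℝ) + 1) ^ 2 * ((n : ℝ) + 2))

theorem fpos_aux_conv (a b m : ℕ) :
    ∑ j ∈ Finset.range (m + 1), ((a + j).choose a : ℝ) * ((b + (m - j)).choose b : ℝ)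
      = ((a + b + 1 + m).choose (a + b + 1) : ℝ) := by
  have h := PowerSeries.invOneSubPow_add ℝ (a + 1) (b + 1)
  have h2 := congrArg (fun u : (PowerSeries ℝ)ˣ => PowerSeries.coeff m (u : PowerSeries ℝ)) h
  simp only [Units.val_mul] at h2
  rw [show a + 1 + (b + 1) = (a + b + 1) + 1 by ring,
    PowerSeries.invOneSubPow_val_succ_eq_mk_add_choose,
    PowerSeries.invOneSubPow_val_succ_eq_mk_add_choose,
    PowerSeries.invOneSubPow_val_succ_eq_mk_add_choose, PowerSeries.coeff_mul,
    Finset.Nat.sum_antidiagonal_eq_sum_range_succ_mk] at h2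
  simp only [PowerSeries.coeff_mk] at h2
  exact h2.symm

theorem fpos_aux_up (a j : ℕ) :
    ((a : ℝ) + 1 + j) * ((a + j).choose a : ℝ) = ((a : ℝ) + 1) * ((a + 1 + j).choose (a + 1) : ℝ) := by
  have h := Nat.add_one_mul_choose_eq (a + j) a
  have h' : (((a + j + 1) * (a + j).choose a : ℕ) : ℝ)
      = (((a + j + 1).choose (a + 1) * (a + 1) : ℕ) : ℝ) := by exact_mod_cast h
  rw [show a + 1 + j = a + j + 1 by ring]
  push_cast at h'
  linarith

theorem fpos_aux_third (a b m : ℕ) :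
    ∑ x ∈ Finset.Icc (a + 1) (m + (a + 1)),
        ((x : ℝ) - fposMean (a + 1) (a + b + 1) (a + b + 1 + m)) ^ 3 *
          fpos (a + 1) (a + b + 1) (a + b + 1 + m) x =
      ((b : ℝ) - a) * (1 + 2 * ((m : ℝ) - 1) / ((a : ℝ) + b + 4)) *
        ((((a : ℝ) + b + m + 2) * m * (a + 1) * (b + 1)) /
          (((a : ℝ) + b + 2) ^ 3 * ((a : ℝ) + b + 3))) := by
  set μ := fposMean (a + 1) (a + b + 1) (a + b + 1 + m) with hμ
  set T : ℝ := ((a + b + 1 + m).choose (a + b + 1) : ℝ) with hT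
  have hTpos : 0 < T := by
    rw [hT]; exact_mod_cast Nat.choose_pos (by omega)
  have hsum : ∑ x ∈ Finset.Icc (a + 1) (m + (a + 1)),
        ((x : ℝ) - μ) ^ 3 * fpos (a + 1) (a + b + 1) (a + b + 1 + m) x =
      ∑ j ∈ Finset.range (m + 1), ((a : ℝ) + 1 + j - μ) ^ 3 *
        (((a + j).choose a : ℝ) * ((b + (m - j)).choose b : ℝ)) / T := by
    rw [Finset.range_eq_Ico, ← Finset.Ico_add_one_right_eq_Icc,
      show a + 1 = 0 + (a + 1) by ring, show m + (0 + (a + 1)) + 1 = (m + 1) + (a + 1) by ring,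
      ← Finset.sum_Ico_add' _ 0 (m + 1) (a + 1)]
    refine Finset.sum_congr rfl fun j hj => ?_
    have hj' : j ≤ m := by simp at hj; omega
    unfold fpos
    rw [show j + (a + 1) - 1 = a + j by omega, show 0 + (a + 1) - 1 = a by omega,
      show a + b + 1 + m - (j + (a + 1)) = b + (m - j) by omega,
      show a + b + 1 - (0 + (a + 1)) = b by omega]
    push_cast
    rw [mul_div_assoc, hT]
    ring
  have e1 := fpos_aux_up (a + b + 1) m
  have e2 := fpos_aux_up (a + b + 2) m
  have e3 := fpos_aux_up (a + b + 3) m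
  have s0 := fpos_aux_conv a b m
  have s1 := fpos_aux_conv (a + 1) b m
  have s2 := fpos_aux_conv (a + 2) b m
  have s3 := fpos_aux_conv (a + 3) b m
  rw [show a + 1 + b + 1 = a + b + 2 by ring] at s1
  rw [show a + 2 + b + 1 = a + b + 3 by ring] at s2
  rw [show a + 3 + b + 1 = a + b + 4 by ring] at s3
  rw [show a + b + 1 + 1 = a + b + 2 by ring, ← hT, ← s1] at e1
  rw [show a + b + 2 + 1 = a + b + 3 by ring, ← s1, ← s2] at e2
  rw [show a + b + 3 + 1 = a + b + 4 by ring, ← s2, ← s3] at e3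
  rw [← hT] at s0
  have key : ∑ j ∈ Finset.range (m + 1), ((a : ℝ) + 1 + j - μ) ^ 3 *
        (((a + j).choose a : ℝ) * ((b + (m - j)).choose b : ℝ)) / T =
      (((a : ℝ) + 1) * (a + 2) * (a + 3) *
        (∑ j ∈ Finset.range (m + 1), ((a + 3 + j).choose (a + 3) : ℝ) * ((b + (m - j)).choose b : ℝ))
      - (3 + 3 * μ) * (((a : ℝ) + 1) * (a + 2)) *
        (∑ j ∈ Finset.range (m + 1), ((a + 2 + j).choose (a + 2) : ℝ) * ((b + (m - j)).choose b : ℝ))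
      + (1 + 3 * μ + 3 * μ ^ 2) * ((a : ℝ) + 1) *
        (∑ j ∈ Finset.range (m + 1), ((a + 1 + j).choose (a + 1) : ℝ) * ((b + (m - j)).choose b : ℝ))
      - μ ^ 3 *
        (∑ j ∈ Finset.range (m + 1), ((a + j).choose a : ℝ) * ((b + (m - j)).choose b : ℝ))) / T := by
    rw [← Finset.sum_div]
    congr 1
    simp only [Finset.mul_sum]
    rw [← Finset.sum_sub_distrib, ← Finset.sum_add_distrib, ← Finset.sum_sub_distrib]
    refine Finset.sum_congr rfl fun j _ => ?_
    have u1 := fpos_aux_up a j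
    have u2 := fpos_aux_up (a + 1) j
    have u3 := fpos_aux_up (a + 2) j
    rw [show a + 1 + 1 = a + 2 by ring] at u2
    rw [show a + 2 + 1 = a + 3 by ring] at u3
    push_cast at u2 u3
    generalize ((a + j).choose a : ℝ) = c0 at *
    generalize ((a + 1 + j).choose (a + 1) : ℝ) = c1 at *
    generalize ((a + 2 + j).choose (a + 2) : ℝ) = c2 at *
    generalize ((a + 3 + j).choose (a + 3) : ℝ) = c3 at *
    generalize ((b + (m - j)).choose b : ℝ) = d at *
    set X : ℝ := (a : ℝ) + 1 + j with hX
    have v1 : ((a : ℝ) + 1) * c1 = X * c0 := u1.symm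
    have v2 : ((a : ℝ) + 1) * (a + 2) * c2 = X * (X + 1) * c0 := by
      linear_combination (-((a : ℝ) + 1)) * u2 - (X + 1) * u1
    have v3 : ((a : ℝ) + 1) * (a + 2) * (a + 3) * c3 = X * (X + 1) * (X + 2) * c0 := by
      linear_combination (-((a : ℝ) + 1) * (a + 2)) * u3 + (X + 2) * v2
    linear_combination (-d) * v3 + (3 + 3 * μ) * d * v2 - (1 + 3 * μ + 3 * μ ^ 2) * d * v1
  rw [hsum, key, s0]
  generalize (∑ j ∈ Finset.range (m + 1), ((a + 3 + j).choose (a + 3) : ℝ) * ((b + (m - j)).choose b : ℝ)) = S3 at *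
  generalize (∑ j ∈ Finset.range (m + 1), ((a + 2 + j).choose (a + 2) : ℝ) * ((b + (m - j)).choose b : ℝ)) = S2 at *
  generalize (∑ j ∈ Finset.range (m + 1), ((a + 1 + j).choose (a + 1) : ℝ) * ((b + (m - j)).choose b : ℝ)) = S1 at *
  push_cast at e1 e2 e3
  have p2 : (0 : ℝ) < (a : ℝ) + b + 2 := by positivity
  have p3 : (0 : ℝ) < (a : ℝ) + b + 3 := by positivity
  have p4 : (0 : ℝ) < (a : ℝ) + b + 4 := by positivity
  have f1 : S1 = ((a : ℝ) + b + 2 + m) * T / ((a : ℝ) + b + 2) := by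
    rw [eq_div_iff p2.ne']; linear_combination -e1
  have f2 : S2 = ((a : ℝ) + b + 3 + m) * S1 / ((a : ℝ) + b + 3) := by
    rw [eq_div_iff p3.ne']; linear_combination -e2
  have f3 : S3 = ((a : ℝ) + b + 4 + m) * S2 / ((a : ℝ) + b + 4) := by
    rw [eq_div_iff p4.ne']; linear_combination -e3
  have hμ' : μ = ((a : ℝ) + 1) * (a + b + 2 + m) / ((a : ℝ) + b + 2) := by
    rw [hμ, fposMean]; push_cast; congr 1 <;> ring
  clear_value μ T
  rw [f3, f2, f1, hμ']
  field_simp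
  ring


/-- For all integers 1 ≤ k ≤ n < N, the skewness of the FPOS distribution
satisfies (Σ_{x=k}^{N−n+k} (x − μ)³ · f(x; k, n, N)) / σ³
  = (n − 2k + 1)·(1 + 2(N − n − 1)/(n + 3))·√((n+2)/((N+1)(N−n)k(n−k+1))). -/
theorem fpos_skewness (k n N : ℕ) (hk : 1 ≤ k) (hkn : k ≤ n) (hnN : n < N) :
    (∑ x ∈ Finset.Icc k (N - n + k),
        ((x : ℝ) - fposMean k n N) ^ 3 * fpos k n N x) / (Real.sqrt (fposVar k n N)) ^ 3 =
      ((n : ℝ) - 2 * (k : ℝ) + 1) * (1 + 2 * ((N : ℝ) - (n : ℝ) - 1) / ((n : ℝ) + 3)) *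
        Real.sqrt (((n : ℝ) + 2) /
          (((N : ℝ) + 1) * ((N : ℝ) - (n : ℝ)) * (k : ℝ) * ((n : ℝ) - (k : ℝ) + 1))) := by
  obtain ⟨a, rfl⟩ : ∃ a, k = a + 1 := ⟨k - 1, by omega⟩
  obtain ⟨b, rfl⟩ : ∃ b, n = a + b + 1 := ⟨n - (a + 1), by omega⟩
  obtain ⟨m, rfl⟩ : ∃ m, N = a + b + 1 + m := ⟨N - (a + b + 1), by omega⟩
  have hm : (0 : ℝ) < m := by
    have : 0 < m := by omega
    exact_mod_cast this
  rw [show a + b + 1 + m - (a + b + 1) + (a + 1) = m + (a + 1) by omega, fpos_aux_third]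
  have hV : fposVar (a + 1) (a + b + 1) (a + b + 1 + m) =
      (((a : ℝ) + b + m + 2) * m * (a + 1) * (b + 1)) /
          (((a : ℝ) + b + 2) ^ 2 * ((a : ℝ) + b + 3)) := by
    unfold fposVar
    push_cast
    congr 1 <;> ring
  set V := fposVar (a + 1) (a + b + 1) (a + b + 1 + m) with hVdef
  clear_value V
  have hVpos : 0 < V := by rw [hV]; positivity
  have p2 : (0 : ℝ) < (a : ℝ) + b + 2 := by positivity
  have hs : Real.sqrt V ^ 2 = V := Real.sq_sqrt hVpos.le
  have hsp : 0 < Real.sqrt V := Real.sqrt_pos.mpr hVpos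
  have hR : Real.sqrt ((((a + b + 1 : ℕ) : ℝ) + 2) /
          ((((a + b + 1 + m : ℕ) : ℝ) + 1) * (((a + b + 1 + m : ℕ) : ℝ) - ((a + b + 1 : ℕ) : ℝ)) *
            ((a + 1 : ℕ) : ℝ) * (((a + b + 1 : ℕ) : ℝ) - ((a + 1 : ℕ) : ℝ) + 1)))
      = 1 / (((a : ℝ) + b + 2) * Real.sqrt V) := by
    rw [Real.sqrt_eq_iff_mul_self_eq_of_pos (by positivity), ← sq]
    rw [div_pow, mul_pow, hs, hV]
    push_cast
    rw [show (a : ℝ) + b + 1 + m - (a + b + 1) = m by ring,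
      show (a : ℝ) + b + 1 - (a + 1) + 1 = b + 1 by ring]
    field_simp
    ring
  rw [hR]
  have hM : (((a : ℝ) + b + m + 2) * m * (a + 1) * (b + 1)) /
          (((a : ℝ) + b + 2) ^ 3 * ((a : ℝ) + b + 3)) = Real.sqrt V ^ 2 / ((a : ℝ) + b + 2) := by
    rw [hs, hV]
    field_simp
  rw [hM]
  generalize Real.sqrt V = s at *
  push_cast
  rw [show (a : ℝ) + b + 1 + m - (a + b + 1) = m by ring,
    show (a : ℝ) + b + 1 + 3 = a + b + 4 by ring]
  field_simp
  ring
end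

section
/- For all integers 1 ≤ k ≤ n < N, the kurtosis of the FPOS distribution satisfies (Σ_{x=k}^{N−n+k} (x − μ)⁴ · f(x; k, n, N)) / σ⁴ = 3 + (1/(N+1))·[ n(n+1)³(n+2)/((N−n)(n+3)(n+4)k(n−k+1)) − 6(n+1)²(n+2)/((N−n)(n+3)(n+4)) + 6(N+1)(n+1)²(n+2)/((n+3)(n+4)k(n−k+1)) − 6(N+1)(5n+11)/((n+3)(n+4)) ], where μ = k(N+1)/(n+1) and σ² = (N+1)(N−n)k(n−k+1)/((n+1)²(n+2)). -/
open Finset in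
theorem fposAux_sum (a b M : ℕ) :
    ∑ i ∈ range (M + 1), (a + i).choose a * (b + (M - i)).choose b
      = (a + b + 1 + M).choose (a + b + 1) := by
  have h1 := PowerSeries.mk_one_pow_eq_mk_choose_add (S := ℤ) a
  have h2 := PowerSeries.mk_one_pow_eq_mk_choose_add (S := ℤ) b
  have h3 := PowerSeries.mk_one_pow_eq_mk_choose_add (S := ℤ) (a + b + 1)
  have h4 : (PowerSeries.mk fun n => ((a + n).choose a : ℤ)) *
      (PowerSeries.mk fun n => ((b + n).choose b : ℤ)) =
      (PowerSeries.mk fun n => ((a + b + 1 + n).choose (a + b + 1) : ℤ)) := by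
    rw [← h1, ← h2, ← h3, ← pow_add]
    congr 1
    ring
  have h5 := congrArg (PowerSeries.coeff M) h4
  rw [PowerSeries.coeff_mul, Finset.Nat.sum_antidiagonal_eq_sum_range_succ_mk] at h5
  simp only [PowerSeries.coeff_mk] at h5
  exact_mod_cast h5

theorem fposAux_step (a i : ℕ) :
    ((a : ℝ) + 1 + i) * ((a + i).choose a : ℝ) = (a + 1) * ((a + 1 + i).choose (a + 1) : ℝ) := by
  have h := Nat.add_one_mul_choose_eq (a + i) a
  have h' : ((a + i + 1 : ℕ) : ℝ) * ((a + i).choose a : ℝ)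
      = ((a + i + 1).choose (a + 1) : ℝ) * ((a + 1 : ℕ) : ℝ) := by exact_mod_cast h
  rw [show a + 1 + i = a + i + 1 by ring]
  push_cast at h'
  linarith

/-- weighted sums, real version -/
theorem fposAux_sumR (a b M : ℕ) :
    ∑ i ∈ Finset.range (M + 1), ((a + i).choose a : ℝ) * ((b + (M - i)).choose b : ℝ)
      = ((a + b + 1 + M).choose (a + b + 1) : ℝ) := by
  exact_mod_cast fposAux_sum a b M

theorem fposAux_choose (a b M : ℕ) :
    ((a + 1 + b + 1 + M).choose (a + 1 + b + 1) : ℝ)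
      = ((a : ℝ) + b + 2 + M) / (a + b + 2) * ((a + b + 1 + M).choose (a + b + 1) : ℝ) := by
  have h := fposAux_step (a + b + 1) M
  rw [show a + 1 + b + 1 = a + b + 1 + 1 by ring]
  push_cast at h
  have : (a : ℝ) + b + 2 ≠ 0 := by positivity
  field_simp
  linarith

theorem fposAux_fourth (a b M : ℕ) (m : ℝ) :
    ∑ i ∈ Finset.range (M + 1), ((a : ℝ) + 1 + i - m) ^ 4 *
      (((a + i).choose a : ℝ) * ((b + (M - i)).choose b : ℝ)) =
    ((a + b + 1 + M).choose (a + b + 1) : ℝ) *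
     ((a + 1) * (a + 2) * (a + 3) * (a + 4) *
        ((a + b + 2 + M) * (a + b + 3 + M) * (a + b + 4 + M) * (a + b + 5 + M)
          / ((a + b + 2) * (a + b + 3) * (a + b + 4) * (a + b + 5)))
      + (-6 - 4 * m) * ((a + 1) * (a + 2) * (a + 3) *
        ((a + b + 2 + M) * (a + b + 3 + M) * (a + b + 4 + M)
          / ((a + b + 2) * (a + b + 3) * (a + b + 4))))
      + (7 + 12 * m + 6 * m ^ 2) * ((a + 1) * (a + 2) *
        ((a + b + 2 + M) * (a + b + 3 + M) / ((a + b + 2) * (a + b + 3))))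
      + (-1 - 4 * m - 6 * m ^ 2 - 4 * m ^ 3) * ((a + 1) *
        ((a + b + 2 + M) / (a + b + 2)))
      + m ^ 4) := by
  have key : ∀ i ∈ Finset.range (M + 1), ((a : ℝ) + 1 + i - m) ^ 4 *
      (((a + i).choose a : ℝ) * ((b + (M - i)).choose b : ℝ)) =
      ((a : ℝ) + 1) * (a + 2) * (a + 3) * (a + 4) *
        (((a + 1 + 1 + 1 + 1 + i).choose (a + 1 + 1 + 1 + 1) : ℝ) * ((b + (M - i)).choose b : ℝ))
      + (-6 - 4 * m) * (((a : ℝ) + 1) * (a + 2) * (a + 3)) *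
        (((a + 1 + 1 + 1 + i).choose (a + 1 + 1 + 1) : ℝ) * ((b + (M - i)).choose b : ℝ))
      + (7 + 12 * m + 6 * m ^ 2) * (((a : ℝ) + 1) * (a + 2)) *
        (((a + 1 + 1 + i).choose (a + 1 + 1) : ℝ) * ((b + (M - i)).choose b : ℝ))
      + (-1 - 4 * m - 6 * m ^ 2 - 4 * m ^ 3) * ((a : ℝ) + 1) *
        (((a + 1 + i).choose (a + 1) : ℝ) * ((b + (M - i)).choose b : ℝ))
      + m ^ 4 * (((a + i).choose a : ℝ) * ((b + (M - i)).choose b : ℝ)) := by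
    intro i _
    have e1 := fposAux_step a i
    have e2 := fposAux_step (a + 1) i
    have e3 := fposAux_step (a + 1 + 1) i
    have e4 := fposAux_step (a + 1 + 1 + 1) i
    push_cast at e1 e2 e3 e4
    generalize ((a + i).choose a : ℝ) = c0 at *
    generalize ((a + 1 + i).choose (a + 1) : ℝ) = c1 at *
    generalize ((a + 1 + 1 + i).choose (a + 1 + 1) : ℝ) = c2 at *
    generalize ((a + 1 + 1 + 1 + i).choose (a + 1 + 1 + 1) : ℝ) = c3 at *
    generalize ((a + 1 + 1 + 1 + 1 + i).choose (a + 1 + 1 + 1 + 1) : ℝ) = c4 at *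
    generalize ((b + (M - i)).choose b : ℝ) = d
    have f2 : ((a : ℝ) + 1) * (a + 2) * c2 = (a + 1 + i) * (a + 2 + i) * c0 := by
      linear_combination (-(a : ℝ) - 1) * e2 - ((a : ℝ) + 2 + i) * e1
    have f3 : ((a : ℝ) + 1) * (a + 2) * (a + 3) * c3
        = (a + 1 + i) * (a + 2 + i) * (a + 3 + i) * c0 := by
      linear_combination (-((a : ℝ) + 1) * (a + 2)) * e3 + ((a : ℝ) + 3 + i) * f2
    have f4 : ((a : ℝ) + 1) * (a + 2) * (a + 3) * (a + 4) * c4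
        = (a + 1 + i) * (a + 2 + i) * (a + 3 + i) * (a + 4 + i) * c0 := by
      linear_combination (-((a : ℝ) + 1) * (a + 2) * (a + 3)) * e4 + ((a : ℝ) + 4 + i) * f3
    linear_combination (-d) * f4 - (-6 - 4 * m) * d * f3 - (7 + 12 * m + 6 * m ^ 2) * d * f2
      + (-1 - 4 * m - 6 * m ^ 2 - 4 * m ^ 3) * d * e1
  rw [Finset.sum_congr rfl key]
  simp only [Finset.sum_add_distrib, ← Finset.mul_sum, fposAux_sumR, fposAux_choose]
  push_cast
  have h2 : (a : ℝ) + b + 2 ≠ 0 := by positivity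
  have h3 : (a : ℝ) + b + 3 ≠ 0 := by positivity
  have h4 : (a : ℝ) + b + 4 ≠ 0 := by positivity
  have h5 : (a : ℝ) + b + 5 ≠ 0 := by positivity
  rw [show (a : ℝ) + 1 + b + 2 = a + b + 3 by ring,
    show (a : ℝ) + 2 + b + 2 = a + b + 4 by ring,
    show (a : ℝ) + 3 + b + 2 = a + b + 5 by ring]
  field_simp

/-- For all integers 1 ≤ k ≤ n < N, the kurtosis of the FPOS distribution
satisfies (Σ_{x=k}^{N−n+k} (x − μ)⁴ · f(x; k, n, N)) / σ⁴
 = 3 + (1/(N+1))·[ n(n+1)³(n+2)/((N−n)(n+3)(n+4)k(n−k+1)) − 6(n+1)²(n+2)/((N−n)(n+3)(n+4))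
   + 6(N+1)(n+1)²(n+2)/((n+3)(n+4)k(n−k+1)) − 6(N+1)(5n+11)/((n+3)(n+4)) ]. -/
theorem fpos_kurtosis (k n N : ℕ) (hk : 1 ≤ k) (hkn : k ≤ n) (hnN : n < N) :
    (∑ x ∈ Finset.Icc k (N - n + k),
        ((x : ℝ) - fposMean k n N) ^ 4 * fpos k n N x) / (Real.sqrt (fposVar k n N)) ^ 4 =
      3 + (1 / ((N : ℝ) + 1)) *
        ((n : ℝ) * ((n : ℝ) + 1) ^ 3 * ((n : ℝ) + 2) /
            (((N : ℝ) - (n : ℝ)) * ((n : ℝ) + 3) * ((n : ℝ) + 4) * (k : ℝ) *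
              ((n : ℝ) - (k : ℝ) + 1)) -
          6 * ((n : ℝ) + 1) ^ 2 * ((n : ℝ) + 2) /
            (((N : ℝ) - (n : ℝ)) * ((n : ℝ) + 3) * ((n : ℝ) + 4)) +
          6 * ((N : ℝ) + 1) * ((n : ℝ) + 1) ^ 2 * ((n : ℝ) + 2) /
            (((n : ℝ) + 3) * ((n : ℝ) + 4) * (k : ℝ) * ((n : ℝ) - (k : ℝ) + 1)) -
          6 * ((N : ℝ) + 1) * (5 * (n : ℝ) + 11) / (((n : ℝ) + 3) * ((n : ℝ) + 4))) := by
  obtain ⟨a, rfl⟩ := Nat.exists_eq_add_of_le' hk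
  obtain ⟨b, rfl⟩ := Nat.exists_eq_add_of_le hkn
  obtain ⟨M, rfl⟩ := Nat.exists_eq_add_of_le hnN.le
  have hM : (M : ℝ) ≠ 0 := by
    have : M ≠ 0 := by omega
    exact_mod_cast this
  have hsum : ∀ m : ℝ, ∑ x ∈ Finset.Icc (a + 1) (a + 1 + b + M - (a + 1 + b) + (a + 1)),
        ((x : ℝ) - m) ^ 4 * fpos (a + 1) (a + 1 + b) (a + 1 + b + M) x
      = (∑ i ∈ Finset.range (M + 1), ((a : ℝ) + 1 + i - m) ^ 4 *
      (((a + i).choose a : ℝ) * ((b + (M - i)).choose b : ℝ))) /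
        ((a + b + 1 + M).choose (a + b + 1) : ℝ) := by
    intro m
    rw [Finset.sum_div, show a + 1 + b + M - (a + 1 + b) + (a + 1) = M + (a + 1) by omega,
      ← Finset.Ico_add_one_right_eq_Icc, Finset.sum_Ico_eq_sum_range,
      show M + (a + 1) + 1 - (a + 1) = M + 1 by omega]
    refine Finset.sum_congr rfl fun i hi => ?_
    have hi' : i ≤ M := by simpa [Nat.lt_succ_iff] using hi
    unfold fpos
    rw [show a + 1 + i - 1 = a + i by omega, show a + 1 - 1 = a by omega,
      show a + 1 + b + M - (a + 1 + i) = b + (M - i) by omega,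
      show a + 1 + b - (a + 1) = b by omega, show a + 1 + b = a + b + 1 by omega]
    push_cast
    ring
  rw [hsum, fposAux_fourth]
  have hC : ((a + b + 1 + M).choose (a + b + 1) : ℝ) ≠ 0 := by
    have := Nat.choose_pos (n := a + b + 1 + M) (k := a + b + 1) (by omega)
    positivity
  rw [mul_div_cancel_left₀ _ hC]
  have hv : 0 ≤ fposVar (a + 1) (a + 1 + b) (a + 1 + b + M) := by
    unfold fposVar
    push_cast
    rw [show (a : ℝ) + 1 + b + M - (a + 1 + b) = M by ring,
      show (a : ℝ) + 1 + b - (a + 1) + 1 = b + 1 by ring]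
    positivity
  have hs : Real.sqrt (fposVar (a + 1) (a + 1 + b) (a + 1 + b + M)) ^ 4
      = fposVar (a + 1) (a + 1 + b) (a + 1 + b + M) ^ 2 := by
    conv_rhs => rw [← Real.sq_sqrt hv]
    ring
  rw [hs]
  unfold fposVar fposMean
  push_cast
  rw [show (a : ℝ) + 1 + b + M - (a + 1 + b) = M by ring,
      show (a : ℝ) + 1 + b - (a + 1) + 1 = b + 1 by ring,
      show (a : ℝ) + 1 + b + 1 = a + b + 2 by ring,
      show (a : ℝ) + 1 + b + 2 = a + b + 3 by ring,
      show (a : ℝ) + 1 + b + 3 = a + b + 4 by ring,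
      show (a : ℝ) + 1 + b + 4 = a + b + 5 by ring,
      show (a : ℝ) + 1 + b + M + 1 = a + b + 2 + M by ring]
  have h1 : (a : ℝ) + 1 ≠ 0 := by positivity
  have h1' : (b : ℝ) + 1 ≠ 0 := by positivity
  have h2 : (a : ℝ) + b + 2 ≠ 0 := by positivity
  have h3 : (a : ℝ) + b + 3 ≠ 0 := by positivity
  have h4 : (a : ℝ) + b + 4 ≠ 0 := by positivity
  have h5 : (a : ℝ) + b + 5 ≠ 0 := by positivity
  have h6 : (a : ℝ) + b + 2 + M ≠ 0 := by positivity
  field_simp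
  ring
end

section
/- For all integers 1 ≤ k ≤ n ≤ N and every integer x with k ≤ x ≤ N − n + k, the beta-binomial mixture identity holds: ∫₀¹ C(N−n, x−k)·u^{x−k}·(1−u)^{N−n−x+k} · (n! / ((k−1)!(n−k)!))·u^{k−1}·(1−u)^{n−k} du = C(x−1, k−1)·C(N−x, n−k) / C(N, n). -/
theorem beta_nat_aux (p q : ℕ) :
    ∫ u in (0:ℝ)..1, u ^ p * (1 - u) ^ q =
      (p.factorial : ℝ) * q.factorial / (p + q + 1).factorial := by
  have h := Complex.betaIntegral_eq_Gamma_mul_div ((p : ℂ) + 1) ((q : ℂ) + 1)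
    (by simp; positivity) (by simp; positivity)
  have e : (p : ℂ) + 1 + (q + 1) = ((p + q + 1 : ℕ) : ℂ) + 1 := by push_cast; ring
  rw [e, Complex.Gamma_nat_eq_factorial, Complex.Gamma_nat_eq_factorial,
    Complex.Gamma_nat_eq_factorial] at h
  unfold Complex.betaIntegral at h
  simp only [add_sub_cancel_right, Complex.cpow_natCast] at h
  have h2 : ((∫ u in (0:ℝ)..1, u ^ p * (1 - u) ^ q : ℝ) : ℂ) =
      (((p.factorial : ℝ) * q.factorial / (p + q + 1).factorial : ℝ) : ℂ) := by
    rw [← intervalIntegral.integral_ofReal]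
    push_cast
    exact h
  exact_mod_cast h2

/-- For all integers 1 ≤ k ≤ n ≤ N and every integer x with
k ≤ x ≤ N − n + k, the beta-binomial mixture identity holds:
∫₀¹ C(N−n, x−k)·u^{x−k}·(1−u)^{N−n−x+k} · (n!/((k−1)!(n−k)!))·u^{k−1}·(1−u)^{n−k} du
 = C(x−1, k−1)·C(N−x, n−k) / C(N, n). -/
theorem fpos_beta_binomial_mixture (k n N x : ℕ) (hk : 1 ≤ k) (hkn : k ≤ n) (hnN : n ≤ N)
    (hkx : k ≤ x) (hxN : x ≤ N - n + k) :
    ∫ u in (0:ℝ)..1,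
        ((N - n).choose (x - k) : ℝ) * u ^ (x - k) * (1 - u) ^ (N - n + k - x) *
          ((Nat.factorial n : ℝ) / ((Nat.factorial (k - 1) : ℝ) * (Nat.factorial (n - k) : ℝ))) * u ^ (k - 1) * (1 - u) ^ (n - k) =
      fpos k n N x := by
  obtain ⟨j, rfl⟩ := Nat.exists_eq_add_of_le' hk
  obtain ⟨m, rfl⟩ := Nat.exists_eq_add_of_le hkn
  obtain ⟨a, rfl⟩ := Nat.exists_eq_add_of_le hkx
  obtain ⟨c, rfl⟩ := Nat.exists_eq_add_of_le hnN
  obtain ⟨b, rfl⟩ : ∃ b, c = a + b := ⟨c - a, by omega⟩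
  unfold fpos
  have e1 : j + 1 + m + (a + b) - (j + 1 + m) = a + b := by omega
  have e2 : j + 1 + a - (j + 1) = a := by omega
  have e3 : a + b + (j + 1) - (j + 1 + a) = b := by omega
  have e4 : j + 1 - 1 = j := by omega
  have e5 : j + 1 + m - (j + 1) = m := by omega
  have e6 : j + 1 + a - 1 = j + a := by omega
  have e7 : j + 1 + m + (a + b) - (j + 1 + a) = m + b := by omega
  rw [e1, e2, e3, e4, e5, e6, e7]
  have hI : ∀ u : ℝ, ((a + b).choose a : ℝ) * u ^ a * (1 - u) ^ b *
      ((Nat.factorial (j + 1 + m) : ℝ) / ((Nat.factorial j : ℝ) * (Nat.factorial m : ℝ))) *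
        u ^ j * (1 - u) ^ m =
      (((a + b).choose a : ℝ) *
      ((Nat.factorial (j + 1 + m) : ℝ) / ((Nat.factorial j : ℝ) * (Nat.factorial m : ℝ)))) *
        (u ^ (j + a) * (1 - u) ^ (m + b)) := by
    intro u
    rw [pow_add, pow_add]; ring
  simp_rw [hI]
  rw [intervalIntegral.integral_const_mul, beta_nat_aux]
  have e8 : j + a + (m + b) + 1 = j + 1 + m + (a + b) := by omega
  rw [e8]
  push_cast
  rw [Nat.cast_add_choose, Nat.cast_add_choose, Nat.cast_add_choose, Nat.cast_add_choose]
  have f := fun i : ℕ => (Nat.cast_ne_zero (R := ℝ)).2 (Nat.factorial_ne_zero i)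
  have := f a
  have := f b
  have := f j
  have := f m
  have := f (a + b)
  have := f (j + 1 + m)
  have := f (j + 1 + m + (a + b))
  field_simp
end

section
/- Let (N_j), (n_j), (k_j) be sequences of integers with 1 ≤ k_j ≤ n_j ≤ N_j for all j, such that N_j → ∞, n_j/N_j → λ and k_j/n_j → φ for fixed constants 0 < λ < 1 and 0 < φ < 1. Then, writing μ_j, σ_j², Skew_j and Kurt_j for the mean, variance, skewness and kurtosis of the FPOS distribution with parameters (k_j, n_j, N_j): (i) μ_j/N_j → φ; (ii) σ_j²/N_j → ((1−λ)/λ)·φ(1−φ); (iii) Skew_j → 0; and (iv) Kurt_j → 3. That is, the FPOS distribution is asymptotically unskewed and mesokurtic along any such limit path. -/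
open Filter Topology

/-- The skewness of the FPOS distribution (third standardized central moment). -/
noncomputable def fposSkew (k n N : ℕ) : ℝ :=
  (∑ x ∈ Finset.Icc k (N - n + k),
      ((x : ℝ) - fposMean k n N) ^ 3 * fpos k n N x) / (Real.sqrt (fposVar k n N)) ^ 3

/-- The kurtosis of the FPOS distribution (fourth standardized central moment). -/
noncomputable def fposKurt (k n N : ℕ) : ℝ :=
  (∑ x ∈ Finset.Icc k (N - n + k),
      ((x : ℝ) - fposMean k n N) ^ 4 * fpos k n N x) / (Real.sqrt (fposVar k n N)) ^ 4

theorem fpos_conv (a b M : ℕ) :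
    ∑ i ∈ Finset.range (M + 1), (((a + i).choose a : ℕ) : ℝ) * (((b + (M - i)).choose b : ℕ) : ℝ)
      = (((a + b + 1 + M).choose (a + b + 1) : ℕ) : ℝ) := by
  have h : (PowerSeries.mk 1 : PowerSeries ℝ) ^ (a + 1) * (PowerSeries.mk 1) ^ (b + 1)
      = (PowerSeries.mk 1) ^ ((a + b + 1) + 1) := by
    rw [← pow_add]; congr 1; ring
  rw [PowerSeries.mk_one_pow_eq_mk_choose_add, PowerSeries.mk_one_pow_eq_mk_choose_add,
    PowerSeries.mk_one_pow_eq_mk_choose_add] at h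
  have h2 := congrArg (PowerSeries.coeff M) h
  rw [PowerSeries.coeff_mul, Finset.Nat.sum_antidiagonal_eq_sum_range_succ_mk] at h2
  simpa using h2

theorem fpos_absorb (m a : ℕ) :
    ((m : ℝ) + 1) * ((m.choose a : ℕ) : ℝ) = ((a : ℝ) + 1) * (((m + 1).choose (a + 1) : ℕ) : ℝ) := by
  have := Nat.add_one_mul_choose_eq m a
  have h : (((m + 1) * m.choose a : ℕ) : ℝ) = (((m + 1)).choose (a + 1) * (a + 1) : ℕ) := by
    rw [this]
  push_cast at h
  linarith

theorem fpos_sum_eq (a b M : ℕ) (g : ℝ → ℝ) :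
    ∑ x ∈ Finset.Icc (a + 1) ((a + b + 1 + M) - (a + b + 1) + (a + 1)),
      g x * fpos (a + 1) (a + b + 1) (a + b + 1 + M) x
    = (∑ i ∈ Finset.range (M + 1), g ((a : ℝ) + 1 + i) * (((a + i).choose a : ℕ) : ℝ) *
        (((b + (M - i)).choose b : ℕ) : ℝ)) / (((a + b + 1 + M).choose (a + b + 1) : ℕ) : ℝ) := by
  have e : Finset.Icc (a + 1) ((a + b + 1 + M) - (a + b + 1) + (a + 1))
      = Finset.Ico (a + 1) (a + 1 + (M + 1)) := by
    ext x; simp only [Finset.mem_Icc, Finset.mem_Ico]; omega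
  rw [e, Finset.sum_Ico_eq_sum_range, Finset.sum_div]
  have e2 : a + 1 + (M + 1) - (a + 1) = M + 1 := by omega
  rw [e2]
  refine Finset.sum_congr rfl fun i hi => ?_
  have hi' : i ≤ M := by simpa [Nat.lt_succ_iff] using hi
  unfold fpos
  have e3 : a + 1 + i - 1 = a + i := by omega
  have e4 : a + 1 - 1 = a := by omega
  have e5 : a + b + 1 + M - (a + 1 + i) = b + (M - i) := by omega
  have e6 : a + b + 1 - (a + 1) = b := by omega
  rw [e3, e4, e5, e6]
  push_cast
  ring

theorem fpos_moments (a b M : ℕ) (mu : ℝ) :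
    let S : ℕ → ℝ := fun r => (((a + b + 1 + M + r).choose (a + b + 1 + r) : ℕ) : ℝ)
    let k : ℝ := a + 1
    (∑ i ∈ Finset.range (M + 1), ((a : ℝ) + 1 + i - mu) ^ 3 * (((a + i).choose a : ℕ) : ℝ) *
        (((b + (M - i)).choose b : ℕ) : ℝ) =
      k * (k + 1) * (k + 2) * S 3 + (-3 - 3 * mu) * (k * (k + 1) * S 2)
        + (1 + 3 * mu + 3 * mu ^ 2) * (k * S 1) - mu ^ 3 * S 0) ∧
    (∑ i ∈ Finset.range (M + 1), ((a : ℝ) + 1 + i - mu) ^ 4 * (((a + i).choose a : ℕ) : ℝ) *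
        (((b + (M - i)).choose b : ℕ) : ℝ) =
      k * (k + 1) * (k + 2) * (k + 3) * S 4 + (-6 - 4 * mu) * (k * (k + 1) * (k + 2) * S 3)
        + (7 + 12 * mu + 6 * mu ^ 2) * (k * (k + 1) * S 2)
        + (-1 - 4 * mu - 6 * mu ^ 2 - 4 * mu ^ 3) * (k * S 1) + mu ^ 4 * S 0) := by
  intro S k
  have hS : ∀ r, ∑ i ∈ Finset.range (M + 1), (((a + r + i).choose (a + r) : ℕ) : ℝ) *
      (((b + (M - i)).choose b : ℕ) : ℝ) = S r := by
    intro r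
    rw [fpos_conv]
    simp only [S]
    congr 2 <;> ring
  have hw : ∀ i r : ℕ, (k + i + r) * (((a + r + i).choose (a + r) : ℕ) : ℝ)
      = (k + r) * (((a + (r + 1) + i).choose (a + (r + 1)) : ℕ) : ℝ) := by
    intro i r
    have h := fpos_absorb (a + r + i) (a + r)
    have e : a + r + i + 1 = a + (r + 1) + i := by ring
    rw [e] at h
    push_cast at h
    simp only [k]
    have e' : a + r + 1 = a + (r + 1) := by ring
    rw [e'] at h
    linear_combination h
  have hw0 := fun i => hw i 0
  have hw1 := fun i => hw i 1
  have hw2 := fun i => hw i 2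
  have hw3 := fun i => hw i 3
  norm_num only [Nat.cast_zero, Nat.cast_one, Nat.cast_ofNat, add_zero] at hw0 hw1 hw2 hw3
  rw [← hS 0, ← hS 1, ← hS 2, ← hS 3, ← hS 4]
  constructor
  · simp only [Finset.mul_sum, ← Finset.sum_add_distrib, ← Finset.sum_sub_distrib]
    refine Finset.sum_congr rfl fun i _ => ?_
    have h0 := hw0 i
    have h1 := hw1 i
    have h2 := hw2 i
    simp only [add_zero]
    generalize (((a + i).choose a : ℕ) : ℝ) = w0 at *
    generalize (((a + 1 + i).choose (a + 1) : ℕ) : ℝ) = w1 at *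
    generalize (((a + 2 + i).choose (a + 2) : ℕ) : ℝ) = w2 at *
    generalize (((a + 3 + i).choose (a + 3) : ℕ) : ℝ) = w3 at *
    generalize (((b + (M - i)).choose b : ℕ) : ℝ) = v at *
    have ek : (a : ℝ) + 1 = k := rfl
    rw [ek]
    generalize (i : ℝ) = y at *
    clear_value k
    have g2 : (k + y) * (k + y + 1) * w0 = k * (k + 1) * w2 := by
      linear_combination (k + y + 1) * h0 + k * h1
    have g3 : (k + y) * (k + y + 1) * (k + y + 2) * w0 = k * (k + 1) * (k + 2) * w3 := by
      linear_combination (k + y + 2) * g2 + k * (k + 1) * h2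
    linear_combination v * (g3 + (-3 - 3 * mu) * g2 + (1 + 3 * mu + 3 * mu ^ 2) * h0)
  · simp only [Finset.mul_sum, ← Finset.sum_add_distrib, ← Finset.sum_sub_distrib]
    refine Finset.sum_congr rfl fun i _ => ?_
    have h0 := hw0 i
    have h1 := hw1 i
    have h2 := hw2 i
    have h3 := hw3 i
    simp only [add_zero]
    generalize (((a + i).choose a : ℕ) : ℝ) = w0 at *
    generalize (((a + 1 + i).choose (a + 1) : ℕ) : ℝ) = w1 at *
    generalize (((a + 2 + i).choose (a + 2) : ℕ) : ℝ) = w2 at *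
    generalize (((a + 3 + i).choose (a + 3) : ℕ) : ℝ) = w3 at *
    generalize (((a + 4 + i).choose (a + 4) : ℕ) : ℝ) = w4 at *
    generalize (((b + (M - i)).choose b : ℕ) : ℝ) = v at *
    have ek : (a : ℝ) + 1 = k := rfl
    rw [ek]
    generalize (i : ℝ) = y at *
    clear_value k
    have g2 : (k + y) * (k + y + 1) * w0 = k * (k + 1) * w2 := by
      linear_combination (k + y + 1) * h0 + k * h1
    have g3 : (k + y) * (k + y + 1) * (k + y + 2) * w0 = k * (k + 1) * (k + 2) * w3 := by
      linear_combination (k + y + 2) * g2 + k * (k + 1) * h2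
    have g4 : (k + y) * (k + y + 1) * (k + y + 2) * (k + y + 3) * w0
        = k * (k + 1) * (k + 2) * (k + 3) * w4 := by
      linear_combination (k + y + 3) * g3 + k * (k + 1) * (k + 2) * h3
    linear_combination v * (g4 + (-6 - 4 * mu) * g3 + (7 + 12 * mu + 6 * mu ^ 2) * g2
      + (-1 - 4 * mu - 6 * mu ^ 2 - 4 * mu ^ 3) * h0)

theorem fpos_central (k n N : ℕ) (h1 : 1 ≤ k) (h2 : k ≤ n) (h3 : n ≤ N) :
    let p : ℝ := n + 1
    let q : ℝ := n + 1 - k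
    let t : ℝ := (N + 1) * (N - n)
    (∑ x ∈ Finset.Icc k (N - n + k), ((x : ℝ) - fposMean k n N) ^ 3 * fpos k n N x
      = t * (k * q) * (q - k) * (2 * N + 1 - n) / (p ^ 3 * (p + 1) * (p + 2))) ∧
    (∑ x ∈ Finset.Icc k (N - n + k), ((x : ℝ) - fposMean k n N) ^ 4 * fpos k n N x
      = t * (k * q) * (3 * (p - 6) * t * (k * q) + 6 * p ^ 2 * t - 6 * p ^ 2 * (k * q)
          + p ^ 3 * (p - 1)) / (p ^ 4 * (p + 1) * (p + 2) * (p + 3))) := by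
  intro p q t
  obtain ⟨a, rfl⟩ : ∃ a, k = a + 1 := ⟨k - 1, by omega⟩
  obtain ⟨b, rfl⟩ : ∃ b, n = a + b + 1 := ⟨n - (a + 1), by omega⟩
  obtain ⟨M, rfl⟩ : ∃ M, N = a + b + 1 + M := ⟨N - (a + b + 1), by omega⟩
  have hm := fpos_moments a b M (fposMean (a + 1) (a + b + 1) (a + b + 1 + M))
  have e3 := fpos_sum_eq a b M (fun x => (x - fposMean (a + 1) (a + b + 1) (a + b + 1 + M)) ^ 3)
  have e4 := fpos_sum_eq a b M (fun x => (x - fposMean (a + 1) (a + b + 1) (a + b + 1 + M)) ^ 4)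
  beta_reduce at e3 e4
  rw [e3, e4]
  rw [hm.1, hm.2]
  clear e3 e4 hm
  have hC : (0 : ℝ) < (((a + b + 1 + M).choose (a + b + 1) : ℕ) : ℝ) := by
    exact_mod_cast Nat.choose_pos (by omega)
  have f : ∀ r : ℕ, (((a + b + 1 + M + (r + 1)).choose (a + b + 1 + (r + 1)) : ℕ) : ℝ)
      = ((a + b + 1 + M : ℕ) + r + 1 : ℝ) / ((a + b + 1 : ℕ) + r + 1 : ℝ) *
        (((a + b + 1 + M + r).choose (a + b + 1 + r) : ℕ) : ℝ) := by
    intro r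
    have h := fpos_absorb (a + b + 1 + M + r) (a + b + 1 + r)
    have hp : (0 : ℝ) < ((a + b + 1 : ℕ) + r + 1 : ℝ) := by positivity
    rw [div_mul_eq_mul_div, eq_div_iff hp.ne']
    rw [Nat.cast_add (a + b + 1 + M) r, Nat.cast_add (a + b + 1) r] at h
    rw [← add_assoc, ← add_assoc]
    linear_combination -h
  have f0 := f 0
  have f1 := f 1
  have f2 := f 2
  have f3 := f 3
  norm_num only [Nat.cast_zero, Nat.cast_one, Nat.cast_ofNat, add_zero, zero_add] at f0 f1 f2 f3
  have hk : ((a + 1 : ℕ) : ℝ) = (a : ℝ) + 1 := by push_cast; ring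
  simp only [fposMean, p, q, t, hk, add_zero]
  rw [f3, f2, f1, f0]
  have hn0 : (0 : ℝ) < ((a + b + 1 : ℕ) : ℝ) := by positivity
  generalize (((a + b + 1 + M).choose (a + b + 1) : ℕ) : ℝ) = C at *
  generalize ((a + b + 1 + M : ℕ) : ℝ) = N at *
  generalize ((a + b + 1 : ℕ) : ℝ) = n at *
  generalize (a : ℝ) + 1 = k at *
  clear f f0 f1 f2 f3
  have p1 : n + 1 ≠ 0 := by positivity
  have p2 : n + 1 + 1 ≠ 0 := by positivity
  have p3 : n + 2 + 1 ≠ 0 := by positivity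
  have p4 : n + 3 + 1 ≠ 0 := by positivity
  have p3' : n + 1 + 2 ≠ 0 := by positivity
  have p4' : n + 1 + 3 ≠ 0 := by positivity
  have e3 : n + 1 + 2 = n + 2 + 1 := by ring
  have e4 : n + 1 + 3 = n + 3 + 1 := by ring
  rw [e3, e4]
  constructor
  · field_simp
    ring
  · field_simp
    ring

/-- Along any limit path N_j → ∞, n_j/N_j → λ, k_j/n_j → φ with
0 < λ < 1 and 0 < φ < 1, the FPOS distribution satisfies: (i) μ_j/N_j → φ;
(ii) σ_j²/N_j → ((1−λ)/λ)·φ(1−φ); (iii) Skew_j → 0; and (iv) Kurt_j → 3. -/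
theorem fpos_asymptotic_moments (N n k : ℕ → ℕ)
    (hbounds : ∀ j, 1 ≤ k j ∧ k j ≤ n j ∧ n j ≤ N j)
    (lam phi : ℝ) (hlam0 : 0 < lam) (hlam1 : lam < 1) (hphi0 : 0 < phi) (hphi1 : phi < 1)
    (hN : Tendsto (fun j => (N j : ℝ)) atTop atTop)
    (hn : Tendsto (fun j => (n j : ℝ) / (N j : ℝ)) atTop (𝓝 lam))
    (hk : Tendsto (fun j => (k j : ℝ) / (n j : ℝ)) atTop (𝓝 phi)) :
    Tendsto (fun j => fposMean (k j) (n j) (N j) / (N j : ℝ)) atTop (𝓝 phi) ∧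
    Tendsto (fun j => fposVar (k j) (n j) (N j) / (N j : ℝ)) atTop
      (𝓝 ((1 - lam) / lam * (phi * (1 - phi)))) ∧
    Tendsto (fun j => fposSkew (k j) (n j) (N j)) atTop (𝓝 0) ∧
    Tendsto (fun j => fposKurt (k j) (n j) (N j)) atTop (𝓝 3) := by
  have hNp : ∀ j, (0 : ℝ) < N j := fun j => by
    have := hbounds j
    exact_mod_cast (by omega : 0 < N j)
  have hnp : ∀ j, (0 : ℝ) < n j := fun j => by
    have := hbounds j
    exact_mod_cast (by omega : 0 < n j)
  have hkn : ∀ j, (k j : ℝ) ≤ n j := fun j => by exact_mod_cast (hbounds j).2.1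
  have hnN : ∀ j, (n j : ℝ) ≤ N j := fun j => by exact_mod_cast (hbounds j).2.2
  have he : Tendsto (fun j => ((N j : ℝ))⁻¹) atTop (𝓝 0) := tendsto_inv_atTop_zero.comp hN
  have htr : Tendsto (fun j => (((N j : ℝ))⁻¹, (n j : ℝ) / (N j : ℝ), (k j : ℝ) / (n j : ℝ)))
      atTop (𝓝 ((0 : ℝ), lam, phi)) := he.prodMk_nhds (hn.prodMk_nhds hk)
  have key : ∀ (A B : ℝ × ℝ × ℝ → ℝ) (f : ℕ → ℝ) (L : ℝ), Continuous A → Continuous B →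
      B (0, lam, phi) ≠ 0 → A (0, lam, phi) / B (0, lam, phi) = L →
      (∀ j, f j = A (((N j : ℝ))⁻¹, (n j : ℝ) / (N j : ℝ), (k j : ℝ) / (n j : ℝ)) /
        B (((N j : ℝ))⁻¹, (n j : ℝ) / (N j : ℝ), (k j : ℝ) / (n j : ℝ))) →
      Tendsto f atTop (𝓝 L) := by
    intro A B f L hA hB h0 hL hf
    rw [← hL, funext hf]
    exact (hA.continuousAt.tendsto.comp htr).div (hB.continuousAt.tendsto.comp htr) h0
  have T1 : Tendsto (fun j => fposMean (k j) (n j) (N j) / (N j : ℝ)) atTop (𝓝 phi) := by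
    refine key (fun z => z.2.1 * z.2.2 * (1 + z.1)) (fun z => z.2.1 + z.1) _ _
      (by fun_prop) (by fun_prop) (by simp [hlam0.ne']) (by simp; field_simp) fun j => ?_
    have h1 := hNp j
    have h2 := hnp j
    have h3 : (n j : ℝ) + 1 ≠ 0 := by positivity
    simp only [fposMean]
    field_simp
  have T2 : Tendsto (fun j => fposVar (k j) (n j) (N j) / (N j : ℝ)) atTop
      (𝓝 ((1 - lam) / lam * (phi * (1 - phi)))) := by
    refine key (fun z => (1 + z.1) * (1 - z.2.1) * (z.2.1 * z.2.2) * (z.2.1 + z.1 - z.2.1 * z.2.2))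
      (fun z => (z.2.1 + z.1) ^ 2 * (z.2.1 + 2 * z.1)) _ _
      (by fun_prop) (by fun_prop) (by simp [hlam0.ne']) (by simp; field_simp) fun j => ?_
    have h1 := hNp j
    have h2 := hnp j
    have h3 : (n j : ℝ) + 1 ≠ 0 := by positivity
    have h4 : (n j : ℝ) + 2 ≠ 0 := by positivity
    simp only [fposVar]
    field_simp
    ring
  have hL : 0 < (1 - lam) / lam * (phi * (1 - phi)) := by
    have : 0 < 1 - lam := by linarith
    have : 0 < 1 - phi := by linarith
    positivity
  have hV : ∀ j, 0 ≤ fposVar (k j) (n j) (N j) := fun j => by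
    have h1 : 0 ≤ (N j : ℝ) - n j := by linarith [hnN j]
    have h2 : 0 ≤ (n j : ℝ) - k j + 1 := by linarith [hkn j]
    unfold fposVar
    positivity
  have T3 : Tendsto (fun j => (∑ x ∈ Finset.Icc (k j) (N j - n j + k j),
      ((x : ℝ) - fposMean (k j) (n j) (N j)) ^ 3 * fpos (k j) (n j) (N j) x) / (N j : ℝ)) atTop
      (𝓝 ((1 - lam) * phi * (1 - phi) * (1 - 2 * phi) * (2 - lam) / lam ^ 2)) := by
    refine key (fun z => (1 + z.1) * (1 - z.2.1) * (z.2.1 * z.2.2) * (z.2.1 + z.1 - z.2.1 * z.2.2)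
        * (z.2.1 + z.1 - 2 * (z.2.1 * z.2.2)) * (2 + z.1 - z.2.1))
      (fun z => (z.2.1 + z.1) ^ 3 * (z.2.1 + 2 * z.1) * (z.2.1 + 3 * z.1)) _ _
      (by fun_prop) (by fun_prop) (by simp [hlam0.ne']) (by simp; field_simp) fun j => ?_
    rw [(fpos_central _ _ _ (hbounds j).1 (hbounds j).2.1 (hbounds j).2.2).1]
    have h1 := hNp j
    have h2 := hnp j
    generalize (N j : ℝ) = N at *
    generalize (n j : ℝ) = n at *
    generalize (k j : ℝ) = k at *
    have h3 : n + 1 ≠ 0 := by positivity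
    have h4 : n + 2 ≠ 0 := by positivity
    have h5 : n + 3 ≠ 0 := by positivity
    have e4 : n + 1 + 1 = n + 2 := by ring
    have e5 : n + 1 + 2 = n + 3 := by ring
    rw [e4, e5]
    field_simp
    ring
  have T4 : Tendsto (fun j => (∑ x ∈ Finset.Icc (k j) (N j - n j + k j),
      ((x : ℝ) - fposMean (k j) (n j) (N j)) ^ 4 * fpos (k j) (n j) (N j) x) / (N j : ℝ) ^ 2) atTop
      (𝓝 (3 * ((1 - lam) / lam * (phi * (1 - phi))) ^ 2)) := by
    refine key (fun z => (1 + z.1) * (1 - z.2.1) * (z.2.1 * z.2.2) * (z.2.1 + z.1 - z.2.1 * z.2.2)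
        * (3 * (z.2.1 - 5 * z.1) * ((1 + z.1) * (1 - z.2.1)) *
            ((z.2.1 * z.2.2) * (z.2.1 + z.1 - z.2.1 * z.2.2))
          + 6 * z.1 * (z.2.1 + z.1) ^ 2 * ((1 + z.1) * (1 - z.2.1))
          - 6 * z.1 * (z.2.1 + z.1) ^ 2 * ((z.2.1 * z.2.2) * (z.2.1 + z.1 - z.2.1 * z.2.2))
          + z.1 * (z.2.1 + z.1) ^ 3 * z.2.1))
      (fun z => (z.2.1 + z.1) ^ 4 * (z.2.1 + 2 * z.1) * (z.2.1 + 3 * z.1) * (z.2.1 + 4 * z.1)) _ _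
      (by fun_prop) (by fun_prop) (by simp [hlam0.ne']) (by simp; field_simp) fun j => ?_
    rw [(fpos_central _ _ _ (hbounds j).1 (hbounds j).2.1 (hbounds j).2.2).2]
    have h1 := hNp j
    have h2 := hnp j
    generalize (N j : ℝ) = N at *
    generalize (n j : ℝ) = n at *
    generalize (k j : ℝ) = k at *
    have h3 : n + 1 ≠ 0 := by positivity
    have h4 : n + 2 ≠ 0 := by positivity
    have h5 : n + 3 ≠ 0 := by positivity
    have h6 : n + 4 ≠ 0 := by positivity
    have e4 : n + 1 + 1 = n + 2 := by ring
    have e5 : n + 1 + 2 = n + 3 := by ring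
    have e6 : n + 1 + 3 = n + 4 := by ring
    rw [e4, e5, e6]
    field_simp
    ring
  refine ⟨T1, T2, ?_, ?_⟩
  · have hs : Tendsto (fun j => (Real.sqrt (N j : ℝ))⁻¹) atTop (𝓝 0) :=
      tendsto_inv_atTop_zero.comp (Real.tendsto_sqrt_atTop.comp hN)
    have hd := ((Real.continuous_sqrt.tendsto _).comp T2).pow 3
    have hne : Real.sqrt ((1 - lam) / lam * (phi * (1 - phi))) ^ 3 ≠ 0 :=
      (pow_pos (Real.sqrt_pos.2 hL) 3).ne'
    have h := (T3.mul hs).div hd hne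
    rw [mul_zero, zero_div] at h
    refine h.congr fun j => ?_
    have h1 := hNp j
    have h2 : 0 < Real.sqrt (N j : ℝ) := Real.sqrt_pos.2 h1
    simp only [fposSkew, Function.comp, Pi.div_apply]
    rw [Real.sqrt_div (hV j), div_pow]
    have h3 : (N j : ℝ) = Real.sqrt (N j : ℝ) ^ 2 := (Real.sq_sqrt h1.le).symm
    generalize hX : (∑ x ∈ Finset.Icc (k j) (N j - n j + k j),
      ((x : ℝ) - fposMean (k j) (n j) (N j)) ^ 3 * fpos (k j) (n j) (N j) x) = X
    generalize Real.sqrt (fposVar (k j) (n j) (N j)) = s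
    generalize Real.sqrt (N j : ℝ) = r at *
    rw [h3, div_div_eq_mul_div]
    congr 1
    field_simp
  · have h := T4.div (T2.pow 2) (pow_pos hL 2).ne'
    rw [mul_div_assoc, div_self (pow_pos hL 2).ne', mul_one] at h
    refine h.congr fun j => ?_
    have h1 := hNp j
    simp only [fposKurt, Pi.div_apply]
    have h4 : Real.sqrt (fposVar (k j) (n j) (N j)) ^ 4 = fposVar (k j) (n j) (N j) ^ 2 := by
      rw [show (4 : ℕ) = 2 * 2 from rfl, pow_mul, Real.sq_sqrt (hV j)]
    rw [h4, div_pow, div_div_div_cancel_right₀ (pow_pos h1 2).ne']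
end

section
/- Let (N_j), (n_j), (k_j) be sequences of integers with 1 ≤ k_j ≤ n_j < N_j for all j, such that N_j → ∞, n_j/N_j → λ and k_j/n_j → φ for fixed constants 0 < λ < 1 and 0 < φ < 1. Then for every real t, the moment generating function of the standardized FPOS random variable converges to that of the standard normal distribution: Σ_{x=k_j}^{N_j−n_j+k_j} exp( t·(x − μ_j)/σ_j )·f(x; k_j, n_j, N_j) → exp(t²/2) as j → ∞, where μ_j and σ_j are the mean and standard deviation of the FPOS distribution with parameters (k_j, n_j, N_j). -/
open Filter Topology

/-- The standard deviation of the FPOS distribution. -/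
noncomputable def fposSD (k n N : ℕ) : ℝ := Real.sqrt (fposVar k n N)


lemma vand (a b M : ℕ) : ∑ y ∈ Finset.range (M + 1),
    (y + a).choose a * (M - y + b).choose b = (M + a + b + 1).choose (a + b + 1) := by
  have h := congrArg (fun u => PowerSeries.coeff (R := ℤ) M (Units.val u))
    (PowerSeries.invOneSubPow_add (S := ℤ) (a + 1) (b + 1))
  have e : a + 1 + (b + 1) = (a + b + 1) + 1 := by ring
  rw [e] at h
  simp only [Units.val_mul, PowerSeries.invOneSubPow_val_succ_eq_mk_add_choose,
    PowerSeries.coeff_mul, PowerSeries.coeff_mk,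
    Finset.Nat.sum_antidiagonal_eq_sum_range_succ_mk] at h
  have h' : (M + a + b + 1) = a + b + 1 + M := by ring
  rw [h']
  zify
  rw [h]
  refine Finset.sum_congr rfl fun y _ => ?_
  rw [add_comm y a, add_comm (M - y) b]

lemma sum_Icc_shift (k M : ℕ) (F : ℕ → ℝ) :
    ∑ x ∈ Finset.Icc k (M + k), F x = ∑ y ∈ Finset.range (M + 1), F (y + k) := by
  have : Finset.Icc k (M + k) = Finset.Ico k (M + k + 1) := by ext; simp
  rw [this, Finset.sum_Ico_eq_sum_range]
  have : M + k + 1 - k = M + 1 := by omega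
  rw [this]
  exact Finset.sum_congr rfl fun y _ => by rw [add_comm]

lemma fpos_shift (a b M y : ℕ) (hy : y ≤ M) : fpos (a + 1) (a + b + 1) (M + a + b + 1) (y + (a + 1)) =
    (((y + a).choose a * (M - y + b).choose b : ℕ) : ℝ) / ((M + a + b + 1).choose (a + b + 1) : ℝ) := by
  unfold fpos
  have h1 : y + (a + 1) - 1 = y + a := by omega
  have h2 : M + a + b + 1 - (y + (a + 1)) = M - y + b := by omega
  have h3 : a + b + 1 - (a + 1) = b := by omega
  rw [h1, h2, h3, Nat.add_sub_cancel]

lemma params {k n N : ℕ} (h1 : 1 ≤ k) (h2 : k ≤ n) (h3 : n < N) :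
    ∃ a b M : ℕ, k = a + 1 ∧ n = a + b + 1 ∧ N = M + a + b + 1 :=
  ⟨k - 1, n - k, N - n, by omega, by omega, by omega⟩

lemma fpos_nonneg (k n N x : ℕ) : 0 ≤ fpos k n N x := by unfold fpos; positivity

lemma fpos_sum {k n N : ℕ} (h1 : 1 ≤ k) (h2 : k ≤ n) (h3 : n < N) :
    ∑ x ∈ Finset.Icc k (N - n + k), fpos k n N x = 1 := by
  obtain ⟨a, b, M, rfl, rfl, rfl⟩ := params h1 h2 h3
  have e : M + a + b + 1 - (a + b + 1) = M := by omega
  rw [e, sum_Icc_shift]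
  rw [Finset.sum_congr rfl fun y hy => fpos_shift a b M y (by simp at hy; omega)]
  rw [← Finset.sum_div, ← Nat.cast_sum, vand]
  apply div_self
  have := Nat.choose_pos (n := M + a + b + 1) (k := a + b + 1) (by omega)
  positivity

lemma w_rec (a b c y : ℕ) :
    ((y + a).choose a * (c + 1 + b).choose b) * ((y + (a + 1)) * (c + 1)) =
    ((y + 1 + a).choose a * (c + b).choose b) * ((y + 1) * (c + 1 + b)) := by
  have h1 : (y + a).choose a * (y + a + 1) = (y + 1 + a).choose a * (y + 1) := by
    have := Nat.choose_mul_succ_eq (y + a) a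
    have e : y + a + 1 - a = y + 1 := by omega
    rw [e] at this
    rw [this, show y + a + 1 = y + 1 + a by ring]
  have h2 : (c + b).choose b * (c + b + 1) = (c + 1 + b).choose b * (c + 1) := by
    have := Nat.choose_mul_succ_eq (c + b) b
    have e : c + b + 1 - b = c + 1 := by omega
    rw [e] at this
    rw [this, show c + b + 1 = c + 1 + b by ring]
  calc _ = ((y + a).choose a * (y + a + 1)) * ((c + 1 + b).choose b * (c + 1)) := by ring
    _ = _ := by rw [h1, ← h2]; ring

lemma fpos_stein {k n N : ℕ} (h1 : 1 ≤ k) (h2 : k ≤ n) (h3 : n < N) (g : ℕ → ℝ) :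
    ∑ x ∈ Finset.Icc k (N - n + k), fpos k n N x * ((x : ℝ) * ((N : ℝ) - n + k - x)) * g (x + 1) =
    ∑ x ∈ Finset.Icc k (N - n + k), fpos k n N x * (((x : ℝ) - k) * ((N : ℝ) + 1 - x)) * g x := by
  obtain ⟨a, b, M, rfl, rfl, rfl⟩ := params h1 h2 h3
  have e : M + a + b + 1 - (a + b + 1) = M := by omega
  rw [e, sum_Icc_shift, sum_Icc_shift, Finset.sum_range_succ, Finset.sum_range_succ' _ M]
  congr 1
  · refine Finset.sum_congr rfl fun y hy => ?_
    have hy : y < M := by simpa using hy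
    obtain ⟨c, rfl⟩ : ∃ c, M = y + 1 + c := ⟨M - y - 1, by omega⟩
    rw [fpos_shift _ _ _ _ (by omega), fpos_shift _ _ _ _ (by omega)]
    have := w_rec a b c y
    have e1 : y + 1 + c - y = c + 1 := by omega
    have e2 : y + 1 + c - (y + 1) = c := by omega
    rw [e1, e2, show y + (a + 1) + 1 = y + 1 + (a + 1) by ring]
    have h : (((y + a).choose a * (c + 1 + b).choose b : ℕ) : ℝ) * (((y:ℝ) + (a + 1)) * (c + 1)) =
      (((y + 1 + a).choose a * (c + b).choose b : ℕ) : ℝ) * (((y:ℝ) + 1) * (c + 1 + b)) := by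
      exact_mod_cast this
    push_cast at h ⊢
    linear_combination (g (y + 1 + (a + 1)) / ((y + 1 + c + a + b + 1).choose (a + b + 1) : ℝ)) * h
  · push_cast; ring

lemma fpos_stein_exp {k n N : ℕ} (h1 : 1 ≤ k) (h2 : k ≤ n) (h3 : n < N) (s : ℝ) :
    ((n : ℝ) + 1) * ∑ x ∈ Finset.Icc k (N - n + k), fpos k n N x *
      (((x : ℝ) - fposMean k n N) * Real.exp (s * (x - fposMean k n N))) =
    (Real.exp s - 1) * ∑ x ∈ Finset.Icc k (N - n + k), fpos k n N x *
      (((x : ℝ) * ((N : ℝ) - n + k - x)) * Real.exp (s * (x - fposMean k n N))) := by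
  have h := fpos_stein h1 h2 h3 (fun x => Real.exp (s * (x - fposMean k n N)))
  have e : ∀ x : ℕ, Real.exp (s * (((x + 1 : ℕ) : ℝ) - fposMean k n N)) =
      Real.exp s * Real.exp (s * (x - fposMean k n N)) := by
    intro x; rw [← Real.exp_add]; congr 1; push_cast; ring
  simp only [e] at h
  have hm : ((n : ℝ) + 1) * fposMean k n N = k * (N + 1) := by
    unfold fposMean; field_simp
  rw [sub_mul, one_mul, Finset.mul_sum, Finset.mul_sum, ← sub_eq_zero]
  rw [← sub_eq_zero] at h
  rw [← neg_eq_zero, ← h]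
  simp only [← Finset.sum_sub_distrib, ← Finset.sum_neg_distrib]
  refine Finset.sum_congr rfl fun x _ => ?_
  linear_combination (fpos k n N x * Real.exp (s * (x - fposMean k n N))) * hm


lemma analytic_lemma (m m' : ℕ → ℝ → ℝ) (hd : ∀ j t, HasDerivAt (m j) (m' j t) t)
    (hpos : ∀ j t, 0 < m j t) (h0 : ∀ j, m j 0 = 1)
    (h1 : ∀ T : ℝ, 0 < T → ∃ K : ℝ, ∀ᶠ j in atTop, ∀ t, |t| ≤ T → |m' j t| ≤ K * m j t)
    (h2 : ∀ T : ℝ, 0 < T → ∃ ε : ℕ → ℝ, Tendsto ε atTop (𝓝 0) ∧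
      ∀ᶠ j in atTop, ∀ t, |t| ≤ T →
        |m' j t - t * m j t| ≤ ε j * (m j t + (m j (t + 1) + m j (t - 1)))) (t : ℝ) :
    Tendsto (fun j => m j t) atTop (𝓝 (Real.exp (t ^ 2 / 2))) := by
  -- bound
  have hb : ∀ T : ℝ, 0 < T → ∃ C : ℝ, 0 < C ∧ ∀ᶠ j in atTop, ∀ t, |t| ≤ T → m j t ≤ C := by
    intro T hT
    obtain ⟨K, hK⟩ := h1 T hT
    refine ⟨Real.exp (K * T), Real.exp_pos _, ?_⟩
    filter_upwards [hK] with j hj t ht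
    have hK0 : 0 ≤ K := by
      have := (abs_nonneg _).trans (hj 0 (by simpa using hT.le))
      rw [h0] at this; linarith
    have := Convex.norm_image_sub_le_of_norm_hasDerivWithin_le (f := fun t => Real.log (m j t))
      (f' := fun t => m' j t / m j t) (s := Set.Icc (-T) T) (C := K) (x := 0) (y := t)
      (fun x _ => ((hd j x).log (hpos j x).ne').hasDerivWithinAt)
      (fun x hx => by
        rw [Real.norm_eq_abs, abs_div, abs_of_pos (hpos j x), div_le_iff₀ (hpos j x)]
        exact hj x (abs_le.2 hx)) (convex_Icc _ _) (by simp [hT.le]) (abs_le.1 ht)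
    simp only [h0, Real.log_one, sub_zero, Real.norm_eq_abs] at this
    rw [← Real.log_le_iff_le_exp (hpos j t)]
    calc _ ≤ _ := le_abs_self _
      _ ≤ _ := this
      _ ≤ _ := by gcongr
  have hT : (0:ℝ) < |t| + 1 := by positivity
  set T := |t| + 1 with hTdef
  obtain ⟨C, hC0, hC⟩ := hb (T + 1) (by linarith)
  obtain ⟨ε, hε, h2'⟩ := h2 T hT
  have hlim : Tendsto (fun j => |ε j| * (3 * C) * |t|) atTop (𝓝 0) := by
    have := (hε.abs.mul_const (3 * C)).mul_const |t|
    simpa using this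
  have key : Tendsto (fun j => m j t * Real.exp (-(t ^ 2 / 2))) atTop (𝓝 1) := by
    rw [tendsto_iff_norm_sub_tendsto_zero]
    refine squeeze_zero' (Eventually.of_forall fun j => norm_nonneg _) ?_ hlim
    filter_upwards [hC, h2'] with j hj hj2
    have hder : ∀ x, HasDerivAt (fun t => m j t * Real.exp (-(t ^ 2 / 2)))
        ((m' j x - x * m j x) * Real.exp (-(x ^ 2 / 2))) x := by
      intro x
      have h3 : HasDerivAt (fun t : ℝ => -(t ^ 2 / 2)) (-x) x := by
        have := ((hasDerivAt_pow 2 x).div_const 2).neg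
        refine this.congr_deriv ?_
        simp
      refine ((hd j x).mul h3.exp).congr_deriv ?_
      ring
    have := Convex.norm_image_sub_le_of_norm_hasDerivWithin_le
      (f := fun t => m j t * Real.exp (-(t ^ 2 / 2)))
      (f' := fun x => (m' j x - x * m j x) * Real.exp (-(x ^ 2 / 2)))
      (s := Set.Icc (-T) T) (C := |ε j| * (3 * C)) (x := 0) (y := t)
      (fun x _ => (hder x).hasDerivWithinAt)
      (fun x hx => by
        have hx' := abs_le.2 hx
        have b1 := hj x (by linarith)
        have b2 := hj (x + 1) ((abs_add_le _ _).trans (by simpa using hx'))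
        have b3 := hj (x - 1) ((abs_sub _ _).trans (by simpa using hx'))
        have p1 := hpos j x
        have p2 := hpos j (x + 1)
        have p3 := hpos j (x - 1)
        rw [Real.norm_eq_abs, abs_mul, Real.abs_exp]
        have e1 : Real.exp (-(x ^ 2 / 2)) ≤ 1 := Real.exp_le_one_iff.2 (by nlinarith [sq_nonneg x])
        calc _ ≤ |m' j x - x * m j x| * 1 := by gcongr
          _ ≤ ε j * (m j x + (m j (x + 1) + m j (x - 1))) := by rw [mul_one]; exact hj2 x hx'
          _ ≤ |ε j| * (m j x + (m j (x + 1) + m j (x - 1))) := by gcongr; exact le_abs_self _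
          _ ≤ _ := by gcongr; linarith) (convex_Icc _ _) (by simp [hT.le])
      (abs_le.1 (by linarith))
    simpa [h0] using this
  have := key.mul_const (Real.exp (t ^ 2 / 2))
  simpa [mul_assoc, ← Real.exp_add] using this


noncomputable def mgfF (k n N : ℕ) (t : ℝ) : ℝ :=
  ∑ x ∈ Finset.Icc k (N - n + k),
    Real.exp (t * ((x : ℝ) - fposMean k n N) / fposSD k n N) * fpos k n N x

noncomputable def mgfF' (k n N : ℕ) (t : ℝ) : ℝ :=
  ∑ x ∈ Finset.Icc k (N - n + k),
    Real.exp (t * ((x : ℝ) - fposMean k n N) / fposSD k n N) *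
      (((x : ℝ) - fposMean k n N) / fposSD k n N) * fpos k n N x

lemma mgfF_deriv (k n N : ℕ) (t : ℝ) : HasDerivAt (mgfF k n N) (mgfF' k n N t) t := by
  unfold mgfF mgfF'
  refine HasDerivAt.fun_sum fun x _ => ?_
  have h : HasDerivAt (fun t : ℝ => t * ((x : ℝ) - fposMean k n N) / fposSD k n N)
      (((x : ℝ) - fposMean k n N) / fposSD k n N) t := by
    refine (((hasDerivAt_id t).mul_const ((x : ℝ) - fposMean k n N)).div_const _).congr_deriv ?_
    simp
  exact h.exp.mul_const _

lemma mgfF_zero {k n N : ℕ} (h1 : 1 ≤ k) (h2 : k ≤ n) (h3 : n < N) : mgfF k n N 0 = 1 := by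
  simp [mgfF, fpos_sum h1 h2 h3]

lemma mgfF_nonneg (k n N : ℕ) (t : ℝ) : 0 ≤ mgfF k n N t :=
  Finset.sum_nonneg fun x _ => mul_nonneg (Real.exp_pos _).le (fpos_nonneg _ _ _ _)

lemma mgfF_pos {k n N : ℕ} (h1 : 1 ≤ k) (h2 : k ≤ n) (h3 : n < N) (t : ℝ) : 0 < mgfF k n N t := by
  refine lt_of_le_of_ne (mgfF_nonneg _ _ _ _) fun h => ?_
  have h' := (Finset.sum_eq_zero_iff_of_nonneg (fun x _ =>
    mul_nonneg (Real.exp_pos _).le (fpos_nonneg _ _ _ _))).1 h.symm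
  have : ∑ x ∈ Finset.Icc k (N - n + k), fpos k n N x = 0 :=
    Finset.sum_eq_zero fun x hx => by
      have := h' x hx
      simpa [(Real.exp_pos _).ne'] using this
  rw [fpos_sum h1 h2 h3] at this
  exact one_ne_zero this

noncomputable def mgfQ (k n N : ℕ) (t : ℝ) : ℝ :=
  ∑ x ∈ Finset.Icc k (N - n + k),
    Real.exp (t * ((x : ℝ) - fposMean k n N) / fposSD k n N) *
      ((x : ℝ) * ((N : ℝ) - n + k - x)) * fpos k n N x

noncomputable def mgfR (k n N : ℕ) (t : ℝ) : ℝ :=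
  ∑ x ∈ Finset.Icc k (N - n + k),
    Real.exp (t * ((x : ℝ) - fposMean k n N) / fposSD k n N) *
      (((x : ℝ) - fposMean k n N) * ((N : ℝ) - n + k - x - fposMean k n N)) * fpos k n N x

lemma fposVar_pos {k n N : ℕ} (h1 : 1 ≤ k) (h2 : k ≤ n) (h3 : n < N) : 0 < fposVar k n N := by
  have h1 : (1:ℝ) ≤ k := by exact_mod_cast h1
  have h2 : (k:ℝ) ≤ n := by exact_mod_cast h2
  have h3 : (n:ℝ) < N := by exact_mod_cast h3
  have a : (0:ℝ) < N - n := by linarith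
  have b : (0:ℝ) < n - k + 1 := by linarith
  have c : (0:ℝ) < k := by linarith
  unfold fposVar
  positivity

lemma fposSD_pos {k n N : ℕ} (h1 : 1 ≤ k) (h2 : k ≤ n) (h3 : n < N) : 0 < fposSD k n N :=
  Real.sqrt_pos.2 (fposVar_pos h1 h2 h3)

lemma fposSD_sq {k n N : ℕ} (h1 : 1 ≤ k) (h2 : k ≤ n) (h3 : n < N) :
    fposSD k n N ^ 2 = fposVar k n N := Real.sq_sqrt (fposVar_pos h1 h2 h3).le

lemma mgfF'_eq {k n N : ℕ} (h1 : 1 ≤ k) (h2 : k ≤ n) (h3 : n < N) (t : ℝ) :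
    ((n : ℝ) + 1) * fposSD k n N * mgfF' k n N t =
      (Real.exp (t / fposSD k n N) - 1) * mgfQ k n N t := by
  have hs := fposSD_pos h1 h2 h3
  have h := fpos_stein_exp h1 h2 h3 (t / fposSD k n N)
  unfold mgfF' mgfQ
  rw [mul_assoc]
  convert h using 2
  · rw [Finset.mul_sum]
    refine Finset.sum_congr rfl fun x _ => ?_
    rw [show t * ((x : ℝ) - fposMean k n N) / fposSD k n N =
      t / fposSD k n N * ((x : ℝ) - fposMean k n N) by ring]
    field_simp
  · refine Finset.sum_congr rfl fun x _ => ?_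
    rw [show t * ((x : ℝ) - fposMean k n N) / fposSD k n N =
      t / fposSD k n N * ((x : ℝ) - fposMean k n N) by ring]
    ring

lemma mgfQ_eq {k n N : ℕ} (h1 : 1 ≤ k) (h2 : k ≤ n) (h3 : n < N) (t : ℝ) :
    mgfQ k n N t = fposSD k n N ^ 2 * (n + 2) * mgfF k n N t + mgfR k n N t := by
  have e : fposSD k n N ^ 2 * (n + 2) = fposMean k n N * ((N : ℝ) - n + k - fposMean k n N) := by
    rw [fposSD_sq h1 h2 h3]
    unfold fposVar fposMean
    field_simp
    ring
  rw [e]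
  unfold mgfQ mgfF mgfR
  rw [Finset.mul_sum, ← Finset.sum_add_distrib]
  refine Finset.sum_congr rfl fun x _ => ?_
  ring

lemma mem_bounds {k n N x : ℕ} (h1 : 1 ≤ k) (h2 : k ≤ n) (h3 : n < N)
    (hx : x ∈ Finset.Icc k (N - n + k)) :
    (0:ℝ) ≤ x ∧ (0:ℝ) ≤ (N : ℝ) - n + k - x ∧ (N : ℝ) - n + k ≤ N + 1 := by
  have hx := (Finset.mem_Icc.1 hx).2
  have a : x + n ≤ N + k := by omega
  have a : (x:ℝ) + n ≤ N + k := by exact_mod_cast a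
  have h2 : (k:ℝ) ≤ n := by exact_mod_cast h2
  refine ⟨by positivity, by linarith, by linarith⟩

lemma mgfQ_le {k n N : ℕ} (h1 : 1 ≤ k) (h2 : k ≤ n) (h3 : n < N) (t : ℝ) :
    |mgfQ k n N t| ≤ ((N : ℝ) + 1) ^ 2 * mgfF k n N t := by
  unfold mgfQ mgfF
  rw [Finset.mul_sum]
  refine (Finset.abs_sum_le_sum_abs _ _).trans (Finset.sum_le_sum fun x hx => ?_)
  obtain ⟨a, b, c⟩ := mem_bounds h1 h2 h3 hx
  have hf := fpos_nonneg k n N x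
  rw [abs_of_nonneg (by positivity)]
  have : (x : ℝ) * ((N : ℝ) - n + k - x) ≤ ((N : ℝ) + 1) ^ 2 := by
    rw [sq]; gcongr <;> linarith
  calc _ ≤ Real.exp (t * ((x : ℝ) - fposMean k n N) / fposSD k n N) *
      ((N : ℝ) + 1) ^ 2 * fpos k n N x := by gcongr
    _ = _ := by ring

lemma mgfR_le {k n N : ℕ} (h1 : 1 ≤ k) (h2 : k ≤ n) (h3 : n < N) (t : ℝ) :
    |mgfR k n N t| ≤ ((N : ℝ) + 1) * fposSD k n N * (mgfF k n N (t + 1) + mgfF k n N (t - 1)) := by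
  unfold mgfR mgfF
  rw [← Finset.sum_add_distrib, Finset.mul_sum]
  refine (Finset.abs_sum_le_sum_abs _ _).trans (Finset.sum_le_sum fun x hx => ?_)
  obtain ⟨a, b, c⟩ := mem_bounds h1 h2 h3 hx
  have hf := fpos_nonneg k n N x
  have hs := fposSD_pos h1 h2 h3
  have hm0 : 0 ≤ fposMean k n N := by unfold fposMean; positivity
  have hm1 : fposMean k n N ≤ N + 1 := by
    unfold fposMean
    rw [div_le_iff₀ (by positivity), mul_comm]
    have h2 : (k:ℝ) ≤ n := by exact_mod_cast h2
    gcongr; linarith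
  set μ := fposMean k n N
  set σ := fposSD k n N
  obtain ⟨w, hw⟩ : ∃ w, w = ((x : ℝ) - μ) / σ := ⟨_, rfl⟩
  have hxw : (x : ℝ) - μ = σ * w := by rw [hw]; field_simp
  have e : ∀ s : ℝ, s * ((x : ℝ) - μ) / σ = s * w := fun s => by rw [hw]; ring
  rw [e, e, e, hxw]
  have hU : |(N : ℝ) - n + k - x - μ| ≤ N + 1 := abs_le.2 ⟨by linarith, by linarith⟩
  have hW : |w| ≤ Real.exp w + Real.exp (-w) := by
    have p1 := Real.add_one_le_exp w
    have p2 := Real.add_one_le_exp (-w)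
    have p3 := Real.exp_pos w
    have p4 := Real.exp_pos (-w)
    exact abs_le.2 ⟨by linarith, by linarith⟩
  rw [abs_mul, abs_mul, abs_mul, abs_mul, Real.abs_exp, abs_of_nonneg hf, abs_of_pos hs]
  calc Real.exp (t * w) * (σ * |w| * |(N : ℝ) - n + k - x - μ|) * fpos k n N x
      ≤ Real.exp (t * w) * (σ * (Real.exp w + Real.exp (-w)) * (N + 1)) * fpos k n N x := by
        gcongr
    _ = _ := by
      rw [show (t + 1) * w = t * w + w by ring, show (t - 1) * w = t * w + -w by ring,
        Real.exp_add, Real.exp_add]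
      ring

lemma bound1 {k n N : ℕ} (h1 : 1 ≤ k) (h2 : k ≤ n) (h3 : n < N) {T t : ℝ}
    (hT : T ≤ fposSD k n N) (ht : |t| ≤ T) :
    |mgfF' k n N t| ≤ 2 * T * (((N : ℝ) + 1) ^ 2 / ((n + 1) * fposVar k n N)) * mgfF k n N t := by
  have hs := fposSD_pos h1 h2 h3
  have h := mgfF'_eq h1 h2 h3 t
  have hQ := mgfQ_le h1 h2 h3 t
  have hm := mgfF_nonneg k n N t
  rw [← fposSD_sq h1 h2 h3]
  set σ := fposSD k n N
  have hu : |t / σ| ≤ T / σ := by rw [abs_div, abs_of_pos hs]; gcongr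
  have hu1 : T / σ ≤ 1 := (div_le_one hs).2 hT
  have he : |Real.exp (t / σ) - 1| ≤ 2 * (T / σ) :=
    (Real.abs_exp_sub_one_le (hu.trans hu1)).trans (by gcongr)
  have hT0 : 0 ≤ T := (abs_nonneg _).trans ht
  have : mgfF' k n N t = (Real.exp (t / σ) - 1) * mgfQ k n N t / ((n + 1) * σ) := by
    rw [← h]; field_simp
  rw [this, abs_div, abs_mul, abs_of_pos (show (0:ℝ) < (n + 1) * σ by positivity)]
  calc _ ≤ 2 * (T / σ) * (((N : ℝ) + 1) ^ 2 * mgfF k n N t) / ((n + 1) * σ) := by gcongr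
    _ = _ := by field_simp

lemma bound2 {k n N : ℕ} (h1 : 1 ≤ k) (h2 : k ≤ n) (h3 : n < N) {T t : ℝ}
    (hT : T ≤ fposSD k n N) (ht : |t| ≤ T) :
    |mgfF' k n N t - t * mgfF k n N t| ≤
      (2 * T ^ 2 / fposSD k n N + T / (n + 1) + 2 * T / fposSD k n N * ((N + 1) / (n + 1))) *
      (mgfF k n N t + (mgfF k n N (t + 1) + mgfF k n N (t - 1))) := by
  have hs := fposSD_pos h1 h2 h3
  have h := mgfF'_eq h1 h2 h3 t
  have hR := mgfR_le h1 h2 h3 t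
  have hm := mgfF_nonneg k n N t
  have hm1 := mgfF_nonneg k n N (t + 1)
  have hm2 := mgfF_nonneg k n N (t - 1)
  rw [mgfQ_eq h1 h2 h3] at h
  set σ := fposSD k n N
  have hT0 : 0 ≤ T := (abs_nonneg _).trans ht
  have hu : |t / σ| ≤ T / σ := by rw [abs_div, abs_of_pos hs]; gcongr
  have hu1 : T / σ ≤ 1 := (div_le_one hs).2 hT
  have he : |Real.exp (t / σ) - 1| ≤ 2 * (T / σ) :=
    (Real.abs_exp_sub_one_le (hu.trans hu1)).trans (by gcongr)
  have he2 : |Real.exp (t / σ) - 1 - t / σ| ≤ (T / σ) ^ 2 :=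
    (Real.abs_exp_sub_one_sub_id_le (hu.trans hu1)).trans (by rw [← sq_abs]; gcongr)
  have e : mgfF' k n N t - t * mgfF k n N t =
      (σ * (Real.exp (t / σ) - 1 - t / σ) * ((n + 2) / (n + 1)) + t / (n + 1)) * mgfF k n N t
      + (Real.exp (t / σ) - 1) * mgfR k n N t / ((n + 1) * σ) := by
    have : mgfF' k n N t = (Real.exp (t / σ) - 1) *
      (σ ^ 2 * (n + 2) * mgfF k n N t + mgfR k n N t) / ((n + 1) * σ) := by
      rw [← h]; field_simp
    rw [this]; field_simp; ring
  have hn2 : ((n:ℝ) + 2) / (n + 1) ≤ 2 := by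
    rw [div_le_iff₀ (by positivity)]
    have : (0:ℝ) ≤ n := by positivity
    linarith
  have c1 : |σ * (Real.exp (t / σ) - 1 - t / σ) * ((n + 2) / (n + 1)) + t / (n + 1)| ≤
      2 * T ^ 2 / σ + T / (n + 1) := by
    refine (abs_add_le _ _).trans ?_
    rw [abs_mul, abs_mul, abs_div t, abs_of_pos hs, abs_of_pos (show (0:ℝ) < (n + 2) / (n + 1) by positivity),
      abs_of_pos (show (0:ℝ) < n + 1 by positivity)]
    calc _ ≤ σ * (T / σ) ^ 2 * 2 + T / (n + 1) := by gcongr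
      _ = _ := by field_simp
  have c2 : |(Real.exp (t / σ) - 1) * mgfR k n N t / ((n + 1) * σ)| ≤
      2 * T / σ * ((N + 1) / (n + 1)) * (mgfF k n N (t + 1) + mgfF k n N (t - 1)) := by
    rw [abs_div, abs_mul, abs_of_pos (show (0:ℝ) < (n + 1) * σ by positivity)]
    calc _ ≤ 2 * (T / σ) * (((N : ℝ) + 1) * σ * (mgfF k n N (t + 1) + mgfF k n N (t - 1)))
          / ((n + 1) * σ) := by gcongr
      _ = _ := by field_simp
  rw [e]
  refine (abs_add_le _ _).trans ?_
  rw [abs_mul, abs_of_nonneg hm]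
  have d1 : 0 ≤ 2 * T ^ 2 / σ + T / (n + 1) := by positivity
  have d2 : 0 ≤ 2 * T / σ * (((N:ℝ) + 1) / (n + 1)) := by positivity
  have d3 : 0 ≤ mgfF k n N (t + 1) + mgfF k n N (t - 1) := by positivity
  have c3 := mul_le_mul_of_nonneg_right c1 hm
  nlinarith [mul_nonneg d1 d3, mul_nonneg d2 hm]

/-- Along any limit path N_j → ∞, n_j/N_j → λ, k_j/n_j → φ with
0 < λ < 1 and 0 < φ < 1, for every real t, the moment generating function of the
standardized FPOS random variable converges to exp(t²/2). -/
theorem fpos_mgf_convergence (N n k : ℕ → ℕ)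
    (hbounds : ∀ j, 1 ≤ k j ∧ k j ≤ n j ∧ n j < N j)
    (lam phi : ℝ) (hlam0 : 0 < lam) (hlam1 : lam < 1) (hphi0 : 0 < phi) (hphi1 : phi < 1)
    (hN : Tendsto (fun j => (N j : ℝ)) atTop atTop)
    (hn : Tendsto (fun j => (n j : ℝ) / (N j : ℝ)) atTop (𝓝 lam))
    (hk : Tendsto (fun j => (k j : ℝ) / (n j : ℝ)) atTop (𝓝 phi)) :
    ∀ t : ℝ,
      Tendsto (fun j =>
          ∑ x ∈ Finset.Icc (k j) (N j - n j + k j),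
            Real.exp (t * ((x : ℝ) - fposMean (k j) (n j) (N j)) / fposSD (k j) (n j) (N j)) *
              fpos (k j) (n j) (N j) x)
        atTop (𝓝 (Real.exp (t ^ 2 / 2))) := by
  intro t
  have hNinv : Tendsto (fun j => (N j : ℝ)⁻¹) atTop (𝓝 0) := tendsto_inv_atTop_zero.comp hN
  have hNpos : ∀ j, (0:ℝ) < N j := fun j => by
    have := hbounds j
    exact_mod_cast (by omega : 0 < N j)
  have hnpos : ∀ j, (0:ℝ) < n j := fun j => by
    have := hbounds j
    exact_mod_cast (by omega : 0 < n j)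
  have hkN : Tendsto (fun j => (k j : ℝ) / N j) atTop (𝓝 (phi * lam)) := by
    refine (hk.mul hn).congr fun j => ?_
    have := hNpos j
    have := hnpos j
    field_simp
  -- variance over N
  set c := (1 + 0) * (1 - lam) * (phi * lam) * (lam - phi * lam + 0) / ((lam + 0) ^ 2 * (lam + 2 * 0))
    with hc
  have hc0 : 0 < c := by
    have a : 0 < 1 - lam := by linarith
    have b : 0 < lam - phi * lam + 0 := by nlinarith
    have : 0 < lam + 0 := by linarith
    have : 0 < lam + 2 * 0 := by linarith
    rw [hc]
    positivity
  have hvar : Tendsto (fun j => fposVar (k j) (n j) (N j) / N j) atTop (𝓝 c) := by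
    have := ((((hNinv.const_add 1).mul (hn.const_sub 1)).mul hkN).mul
      ((hn.sub hkN).add hNinv)).div (((hn.add hNinv).pow 2).mul (hn.add (hNinv.const_mul 2)))
      (by simp [hlam0.ne'])
    refine this.congr fun j => ?_
    have := hNpos j
    unfold fposVar
    simp only [Pi.div_apply]
    field_simp
  have hvarT : Tendsto (fun j => fposVar (k j) (n j) (N j)) atTop atTop := by
    refine (hN.atTop_mul_pos hc0 hvar).congr fun j => ?_
    have := hNpos j
    field_simp
  have hsd : Tendsto (fun j => fposSD (k j) (n j) (N j)) atTop atTop :=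
    Real.tendsto_sqrt_atTop.comp hvarT
  have hnT : Tendsto (fun j => (n j : ℝ) + 1) atTop atTop := by
    refine tendsto_atTop_add_const_right _ _ ((hN.atTop_mul_pos hlam0 hn).congr fun j => ?_)
    have := hNpos j
    field_simp
  have hratio : Tendsto (fun j => ((N j : ℝ) + 1) / (n j + 1)) atTop (𝓝 ((1 + 0) / (lam + 0))) := by
    refine ((hNinv.const_add 1).div (hn.add hNinv) (by simp [hlam0.ne'])).congr fun j => ?_
    have := hNpos j
    simp only [Pi.div_apply]
    field_simp
  have hratio2 : Tendsto (fun j => ((N j : ℝ) + 1) ^ 2 / ((n j + 1) * fposVar (k j) (n j) (N j)))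
      atTop (𝓝 ((1 + 0) / (lam + 0) * ((1 + 0) / c))) := by
    refine (hratio.mul ((hNinv.const_add 1).div hvar hc0.ne')).congr fun j => ?_
    have := hNpos j
    have := fposVar_pos (hbounds j).1 (hbounds j).2.1 (hbounds j).2.2
    simp only [Pi.div_apply]
    field_simp
  refine analytic_lemma (fun j => mgfF (k j) (n j) (N j)) (fun j => mgfF' (k j) (n j) (N j))
    (fun j t => mgfF_deriv _ _ _ _)
    (fun j t => mgfF_pos (hbounds j).1 (hbounds j).2.1 (hbounds j).2.2 t)
    (fun j => mgfF_zero (hbounds j).1 (hbounds j).2.1 (hbounds j).2.2) ?_ ?_ t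
  · intro T hT
    refine ⟨2 * T * ((1 + 0) / (lam + 0) * ((1 + 0) / c) + 1), ?_⟩
    filter_upwards [hsd.eventually_ge_atTop T, hratio2.eventually_le_const (lt_add_one _)]
      with j hj hj2 t ht
    have hm := mgfF_nonneg (k j) (n j) (N j) t
    refine (bound1 (hbounds j).1 (hbounds j).2.1 (hbounds j).2.2 hj ht).trans ?_
    gcongr
  · intro T hT
    refine ⟨fun j => 2 * T ^ 2 / fposSD (k j) (n j) (N j) + T / (n j + 1) +
      2 * T / fposSD (k j) (n j) (N j) * ((N j + 1) / (n j + 1)), ?_, ?_⟩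
    · have := ((hsd.const_div_atTop (2 * T ^ 2)).add (hnT.const_div_atTop T)).add
        ((hsd.const_div_atTop (2 * T)).mul hratio)
      simpa using this
    · filter_upwards [hsd.eventually_ge_atTop T] with j hj t ht
      exact bound2 (hbounds j).1 (hbounds j).2.1 (hbounds j).2.2 hj ht
end

section
/- Let (N_j), (n_j), (k_j) be sequences of integers with 1 ≤ k_j ≤ n_j < N_j for all j, such that N_j → ∞, n_j/N_j → 1, k_j/N_j → 0 and k_j(N_j − n_j)/N_j → ∞. Then for every real t, Σ_{x=k_j}^{N_j−n_j+k_j} exp( t·(x − μ_j)/σ_j )·f(x; k_j, n_j, N_j) → exp(t²/2) as j → ∞, where μ_j and σ_j are the mean and standard deviation of the FPOS distribution with parameters (k_j, n_j, N_j). -/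
open Filter Topology

lemma aux_stein (m : ℕ) (k b : ℝ) (w : ℕ → ℝ)
    (hrec : ∀ y < m, w (y+1) * ((y:ℝ)+1) * (b + m - y) = w y * (k + y) * (m - y)) (u : ℝ) :
    Real.exp u * ∑ y ∈ Finset.range (m+1), (k + y) * (m - y) * (w y * Real.exp (u * y)) =
      ∑ y ∈ Finset.range (m+1), y * (b + m - y + 1) * (w y * Real.exp (u * y)) := by
  rw [Finset.sum_range_succ, Finset.sum_range_succ']
  simp only [sub_self, mul_zero, zero_mul, add_zero, Nat.cast_zero]
  rw [Finset.mul_sum]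
  refine Finset.sum_congr rfl fun y hy => ?_
  have h := hrec y (Finset.mem_range.1 hy)
  have he : Real.exp (u * ((y+1 : ℕ):ℝ)) = Real.exp u * Real.exp (u * y) := by
    rw [← Real.exp_add]; push_cast; ring_nf
  rw [he]
  push_cast
  linear_combination (-(Real.exp u * Real.exp (u * y))) * h

lemma aux_log (m : ℕ) (k b : ℝ) (hk : 0 < k) (hb : 0 ≤ b) (w : ℕ → ℝ)
    (hw : ∀ y, 0 ≤ w y) (hsum : ∑ y ∈ Finset.range (m+1), w y = 1)
    (hrec : ∀ y < m, w (y+1) * ((y:ℝ)+1) * (b + m - y) = w y * (k + y) * (m - y))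
    (s : ℝ) (hs : |s| ≤ 1) (hs2 : 4 * |s| * ((m + k) / (k + b + 1)) ≤ 1) :
    0 < ∑ y ∈ Finset.range (m+1), w y * Real.exp (s * y) ∧
    |Real.log (∑ y ∈ Finset.range (m+1), w y * Real.exp (s * y))
      - (k * m / (k + b + 1)) * (Real.exp s - 1)|
      ≤ 12 * ((m + k) / (k + b + 1)) * (k * m / (k + b + 1)) * s ^ 2 := by
  set ε : ℝ := (m + k) / (k + b + 1) with hε
  set l : ℝ := k * m / (k + b + 1) with hl
  have hn : 0 < k + b + 1 := by positivity
  have hε0 : 0 ≤ ε := by positivity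
  have hl0 : 0 ≤ l := by positivity
  set G : ℝ → ℝ := fun u => ∑ y ∈ Finset.range (m+1), w y * Real.exp (u * y) with hG
  set G1 : ℝ → ℝ := fun u => ∑ y ∈ Finset.range (m+1), y * (w y * Real.exp (u * y)) with hG1
  set G2 : ℝ → ℝ := fun u => ∑ y ∈ Finset.range (m+1), (y:ℝ) ^ 2 * (w y * Real.exp (u * y)) with hG2
  have hpos : ∀ u, 0 < G u := by
    intro u
    have hne : ∃ y ∈ Finset.range (m+1), 0 < w y := by
      by_contra! hcon
      have : ∑ y ∈ Finset.range (m+1), w y ≤ 0 := Finset.sum_nonpos hcon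
      linarith
    obtain ⟨y, hy, hy'⟩ := hne
    exact Finset.sum_pos' (fun i _ => mul_nonneg (hw i) (Real.exp_pos _).le)
      ⟨y, hy, mul_pos hy' (Real.exp_pos _)⟩
  have hG10 : ∀ u, 0 ≤ G1 u := fun u => Finset.sum_nonneg fun y _ =>
    mul_nonneg (Nat.cast_nonneg _) (mul_nonneg (hw y) (Real.exp_pos _).le)
  have hG20 : ∀ u, 0 ≤ G2 u := fun u => Finset.sum_nonneg fun y _ =>
    mul_nonneg (sq_nonneg _) (mul_nonneg (hw y) (Real.exp_pos _).le)
  have hG21 : ∀ u, G2 u ≤ m * G1 u := by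
    intro u
    simp only [hG1, hG2, Finset.mul_sum]
    refine Finset.sum_le_sum fun y hy => ?_
    have h1 : (y:ℝ) ≤ m := by exact_mod_cast Nat.lt_succ_iff.1 (Finset.mem_range.1 hy)
    have h2 := mul_nonneg (Nat.cast_nonneg (α := ℝ) y) (mul_nonneg (hw y) (Real.exp_pos (u * y)).le)
    nlinarith [mul_le_mul_of_nonneg_right h1 h2]
  have hode : ∀ u, Real.exp u * (k * m * G u + (m - k) * G1 u - G2 u)
      = (b + m + 1) * G1 u - G2 u := by
    intro u
    have h := aux_stein m k b w hrec u
    have e1 : ∑ y ∈ Finset.range (m+1), (k + y) * (m - y) * (w y * Real.exp (u * y))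
        = k * m * G u + (m - k) * G1 u - G2 u := by
      simp only [hG, hG1, hG2, Finset.mul_sum, ← Finset.sum_add_distrib, ← Finset.sum_sub_distrib]
      exact Finset.sum_congr rfl fun y _ => by ring
    have e2 : ∑ y ∈ Finset.range (m+1), y * (b + m - y + 1) * (w y * Real.exp (u * y))
        = (b + m + 1) * G1 u - G2 u := by
      simp only [hG1, hG2, Finset.mul_sum, ← Finset.sum_sub_distrib]
      exact Finset.sum_congr rfl fun y _ => by ring
    rw [← e1, ← e2, h]
  have hderiv : ∀ u, HasDerivAt G (G1 u) u := by
    intro u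
    simp only [hG, hG1]
    refine HasDerivAt.fun_sum fun y _ => ?_
    have h1 : HasDerivAt (fun u : ℝ => u * (y:ℝ)) (1 * (y:ℝ)) u := (hasDerivAt_id u).mul_const _
    have h2 := (h1.exp).const_mul (w y)
    exact h2.congr_deriv (by ring)
  have hbound : ∀ u, |u| ≤ |s| → |G1 u / G u - l * Real.exp u| ≤ 12 * ε * l * |s| := by
    intro u hu
    have hg := hpos u
    set A := G1 u / G u with hA
    have hA0 : 0 ≤ A := div_nonneg (hG10 u) hg.le
    have hGA : G1 u = A * G u := by rw [hA]; field_simp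
    set B := G2 u / G u with hB
    have hGB : G2 u = B * G u := by rw [hB]; field_simp
    have hB0 : 0 ≤ B := div_nonneg (hG20 u) hg.le
    have hBm : B ≤ m * A := by
      rw [hB, hA, ← mul_div_assoc]
      exact div_le_div_of_nonneg_right (hG21 u) hg.le
    have ho : Real.exp u * (k * m + (m - k) * A - B) = (b + m + 1) * A - B := by
      have := hode u
      rw [hGA, hGB] at this
      apply mul_right_cancel₀ hg.ne'
      linear_combination this
    have hz : |Real.exp u - 1| ≤ 2 * |u| := Real.abs_exp_sub_one_le (hu.trans hs)
    have key : A - l * Real.exp u = (Real.exp u - 1) * (((m - k) * A - B) / (k + b + 1)) := by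
      rw [hl]
      field_simp
      linear_combination -ho
    have hbr : |((m - k) * A - B) / (k + b + 1)| ≤ ε * A := by
      rw [abs_div, abs_of_pos hn, hε, div_mul_eq_mul_div]
      refine div_le_div_of_nonneg_right ?_ hn.le
      have hkA : 0 ≤ k * A := by positivity
      have hmA : 0 ≤ (m:ℝ) * A := by positivity
      rw [abs_le]; constructor <;> nlinarith
    have hεA : 0 ≤ ε * A := by positivity
    have h1 : |A - l * Real.exp u| ≤ 2 * |s| * (ε * A) := by
      rw [key, abs_mul]
      exact mul_le_mul (hz.trans (by linarith)) hbr (abs_nonneg _) (by positivity)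
    have hexp : Real.exp u ≤ 3 := by
      have : Real.exp u ≤ Real.exp 1 := Real.exp_le_exp.2 ((le_abs_self u).trans (hu.trans hs))
      linarith [Real.exp_one_lt_d9]
    have hAle : A ≤ 6 * l := by
      have h2 := (abs_le.1 h1).2
      have h3 : 4 * |s| * ε * A ≤ 1 * A := mul_le_mul_of_nonneg_right hs2 hA0
      have h4 := mul_le_mul_of_nonneg_left hexp hl0
      nlinarith
    calc _ ≤ 2 * |s| * (ε * A) := h1
      _ ≤ 2 * |s| * (ε * (6 * l)) := by gcongr
      _ = _ := by ring
  refine ⟨hpos s, ?_⟩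
  have hφ : ∀ u, HasDerivAt (fun u => Real.log (G u) - l * (Real.exp u - 1))
      (G1 u / G u - l * Real.exp u) u := by
    intro u
    exact ((hderiv u).log (hpos u).ne').sub (((Real.hasDerivAt_exp u).sub_const 1).const_mul l)
  have hmv := Convex.norm_image_sub_le_of_norm_hasDerivWithin_le
    (f := fun u => Real.log (G u) - l * (Real.exp u - 1))
    (f' := fun u => G1 u / G u - l * Real.exp u) (s := Set.Icc (-|s|) |s|) (x := 0) (y := s)
    (C := 12 * ε * l * |s|)
    (fun u _ => (hφ u).hasDerivWithinAt)
    (fun u hu => hbound u (abs_le.2 hu)) (convex_Icc _ _)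
    ⟨by simp, by simp⟩ ⟨neg_abs_le s, le_abs_self s⟩
  have hG0 : G 0 = 1 := by simp [hG, hsum]
  simp only [hG0, Real.log_one, Real.exp_zero, sub_self, mul_zero, sub_zero, Real.norm_eq_abs] at hmv
  calc _ ≤ 12 * ε * l * |s| * |s| := hmv
    _ = _ := by rw [mul_assoc, abs_mul_abs_self]; ring

lemma aux_vdm (a b m : ℕ) : ∑ y ∈ Finset.range (m+1), (a + y).choose a * (b + (m - y)).choose b
    = (m + (a + b + 1)).choose (a + b + 1) := by
  have h := congrArg Units.val (PowerSeries.invOneSubPow_add ℤ (a+1) (b+1))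
  rw [show a + 1 + (b + 1) = (a + b + 1) + 1 by ring, Units.val_mul] at h
  simp only [PowerSeries.invOneSubPow_val_succ_eq_mk_add_choose] at h
  have h2 := congrArg (PowerSeries.coeff m) h
  rw [PowerSeries.coeff_mul, Finset.Nat.sum_antidiagonal_eq_sum_range_succ_mk] at h2
  simp only [PowerSeries.coeff_mk] at h2
  rw [add_comm m (a + b + 1)]
  exact_mod_cast h2.symm

lemma aux_rec (a b m y : ℕ) (hy : y < m) :
   (a + (y+1)).choose a * (b + (m - (y+1))).choose b * (y+1) * (b + (m - y))
    = (a + y).choose a * (b + (m - y)).choose b * (a + 1 + y) * (m - y) := by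
  obtain ⟨d, rfl⟩ : ∃ d, m = y + 1 + d := ⟨m - (y+1), by omega⟩
  have e1 : y + 1 + d - y = d + 1 := by omega
  have e2 : y + 1 + d - (y+1) = d := by omega
  rw [e1, e2]
  have h1 : (a + (y+1)).choose a * (y+1) = (a+y).choose a * (a + 1 + y) := by
    have := Nat.choose_mul_succ_eq (a+y) a
    rw [show a + y + 1 - a = y + 1 by omega] at this
    rw [← add_assoc, ← this]; ring
  have h2 : (b + (d+1)).choose b * (d+1) = (b+d).choose b * (b + (d + 1)) := by
    have := Nat.choose_mul_succ_eq (b+d) b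
    rw [show b + d + 1 - b = d + 1 by omega] at this
    rw [← add_assoc, ← this]
  linear_combination (b+d).choose b * (b + (d+1)) * h1 - (a+y).choose a * (a+1+y) * h2

lemma aux_point (k n N : ℕ) (h1 : 1 ≤ k) (h2 : k ≤ n) (h3 : n < N) (s : ℝ) (hs : |s| ≤ 1)
    (hs2 : 4 * |s| * (((N:ℝ) - n + k) / ((n:ℝ) + 1)) ≤ 1) :
    0 < ∑ x ∈ Finset.Icc k (N - n + k), Real.exp (s * ((x : ℝ) - fposMean k n N)) * fpos k n N x ∧
    |Real.log (∑ x ∈ Finset.Icc k (N - n + k),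
        Real.exp (s * ((x : ℝ) - fposMean k n N)) * fpos k n N x)
      - (k * ((N:ℝ) - n) / ((n:ℝ) + 1)) * s ^ 2 / 2| ≤
      (k * ((N:ℝ) - n) / ((n:ℝ) + 1)) * s ^ 2 *
        (12 * (((N:ℝ) - n + k) / ((n:ℝ) + 1)) + |s|) := by
  obtain ⟨a, rfl⟩ : ∃ a, k = a + 1 := ⟨k - 1, by omega⟩
  obtain ⟨b, rfl⟩ : ∃ b, n = a + 1 + b := ⟨n - (a+1), by omega⟩
  obtain ⟨m, rfl⟩ : ∃ m, N = a + 1 + b + m := ⟨N - (a + 1 + b), by omega⟩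
  have hC : (0:ℝ) < ((a + 1 + b + m).choose (a + 1 + b) : ℝ) := by
    exact_mod_cast Nat.choose_pos (by omega)
  have hfp : ∀ y ≤ m, fpos (a+1) (a+1+b) (a+1+b+m) (a+1+y) =
      (((a + y).choose a * (b + (m - y)).choose b : ℕ):ℝ) / ((a + 1 + b + m).choose (a + 1 + b) : ℝ) := by
    intro y hy
    unfold fpos
    rw [show a + 1 + y - 1 = a + y by omega, show a + 1 - 1 = a by omega,
      show a + 1 + b + m - (a + 1 + y) = b + (m - y) by omega, show a + 1 + b - (a+1) = b by omega]
  set w : ℕ → ℝ := fun y => (((a + y).choose a * (b + (m - y)).choose b : ℕ):ℝ) /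
    ((a + 1 + b + m).choose (a + 1 + b) : ℝ) with hw
  have hw0 : ∀ y, 0 ≤ w y := fun y => by positivity
  have hsum : ∑ y ∈ Finset.range (m+1), w y = 1 := by
    simp only [hw]
    rw [← Finset.sum_div, ← Nat.cast_sum, aux_vdm,
      show m + (a + b + 1) = a + 1 + b + m by ring, show a + b + 1 = a + 1 + b by ring]
    exact div_self hC.ne'
  have hrec : ∀ y < m, w (y+1) * ((y:ℝ)+1) * ((b:ℝ) + m - y) = w y * (((a+1:ℕ):ℝ) + y) * (m - y) := by
    intro y hy
    have h := aux_rec a b m y hy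
    have h' := congrArg (Nat.cast (R := ℝ)) h
    simp only [hw]
    push_cast [Nat.cast_sub hy.le] at h' ⊢
    field_simp
    linear_combination h'
  have hcast : ((a + 1 + b + m : ℕ):ℝ) - ((a+1+b : ℕ):ℝ) = m := by push_cast; ring
  have hcast2 : ((a+1+b : ℕ):ℝ) + 1 = ((a+1:ℕ):ℝ) + b + 1 := by push_cast; ring
  rw [hcast, hcast2] at hs2
  rw [hcast, hcast2]
  obtain ⟨hp, hl⟩ := aux_log m ((a+1:ℕ):ℝ) b (by positivity) (by positivity) w hw0 hsum hrec s hs hs2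
  set G := ∑ y ∈ Finset.range (m+1), w y * Real.exp (s * y) with hG
  set l := ((a+1:ℕ):ℝ) * m / (((a+1:ℕ):ℝ) + b + 1) with hldef
  have hl0 : 0 ≤ l := by positivity
  have hmean : fposMean (a+1) (a+1+b) (a+1+b+m) = ((a+1:ℕ):ℝ) + l := by
    rw [hldef]; unfold fposMean
    have : ((a+1:ℕ):ℝ) + b + 1 ≠ 0 := by positivity
    rw [hcast2]
    field_simp
    push_cast
    ring
  have hS : ∑ x ∈ Finset.Icc (a+1) (a+1+b+m - (a+1+b) + (a+1)),
      Real.exp (s * ((x : ℝ) - fposMean (a+1) (a+1+b) (a+1+b+m))) * fpos (a+1) (a+1+b) (a+1+b+m) x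
      = Real.exp (-(s * l)) * G := by
    rw [show a+1+b+m - (a+1+b) + (a+1) = m + (a+1) by omega, hG, Finset.mul_sum,
      ← Finset.Ico_add_one_right_eq_Icc, Finset.sum_Ico_eq_sum_range,
      show m + (a+1) + 1 - (a+1) = m + 1 by omega]
    refine Finset.sum_congr rfl fun y hy => ?_
    rw [hfp y (Nat.lt_succ_iff.1 (Finset.mem_range.1 hy)), hmean]
    have : Real.exp (s * (((a+1+y : ℕ):ℝ) - (((a+1:ℕ):ℝ) + l))) =
      Real.exp (-(s*l)) * Real.exp (s * y) := by
      rw [← Real.exp_add]; congr 1; push_cast; ring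
    rw [this]; simp only [hw]; ring
  rw [hS]
  refine ⟨mul_pos (Real.exp_pos _) hp, ?_⟩
  rw [Real.log_mul (Real.exp_pos _).ne' hp.ne', Real.log_exp]
  have hb := Real.exp_bound hs (n := 3) (by norm_num)
  have hb2 : |Real.exp s - 1 - s - s^2/2| ≤ s^2 * |s| := by
    have e : Real.exp s - ∑ i ∈ Finset.range 3, s ^ i / (i.factorial : ℝ) = Real.exp s - 1 - s - s^2/2 := by
      simp [Finset.sum_range_succ, Nat.factorial]; ring
    rw [e] at hb
    refine hb.trans ?_
    have e3 : |s|^3 = s^2 * |s| := by rw [pow_succ, sq_abs]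
    rw [e3]
    norm_num [Nat.factorial]
    have : 0 ≤ s^2 * |s| := by positivity
    nlinarith
  have hb3 : |l * (Real.exp s - 1 - s - s^2/2)| ≤ l * (s^2 * |s|) := by
    rw [abs_mul, abs_of_nonneg hl0]; gcongr
  have e : -(s * l) + Real.log G - l * s^2 / 2 = (Real.log G - l * (Real.exp s - 1))
      + l * (Real.exp s - 1 - s - s^2/2) := by ring
  rw [e]
  refine (abs_add_le _ _).trans ((add_le_add hl hb3).trans (le_of_eq ?_))
  ring

/-- Along any limit path N_j → ∞, n_j/N_j → 1, k_j/N_j → 0 and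
k_j(N_j − n_j)/N_j → ∞, for every real t, the moment generating function of the
standardized FPOS random variable converges to exp(t²/2). -/
theorem fpos_mgf_convergence_boundary (N n k : ℕ → ℕ)
    (hbounds : ∀ j, 1 ≤ k j ∧ k j ≤ n j ∧ n j < N j)
    (hN : Tendsto (fun j => (N j : ℝ)) atTop atTop)
    (hn : Tendsto (fun j => (n j : ℝ) / (N j : ℝ)) atTop (𝓝 1))
    (hk : Tendsto (fun j => (k j : ℝ) / (N j : ℝ)) atTop (𝓝 0))
    (hkN : Tendsto (fun j => (k j : ℝ) * ((N j : ℝ) - (n j : ℝ)) / (N j : ℝ)) atTop atTop) :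
    ∀ t : ℝ,
      Tendsto (fun j =>
          ∑ x ∈ Finset.Icc (k j) (N j - n j + k j),
            Real.exp (t * ((x : ℝ) - fposMean (k j) (n j) (N j)) / fposSD (k j) (n j) (N j)) *
              fpos (k j) (n j) (N j) x)
        atTop (𝓝 (Real.exp (t ^ 2 / 2))) := by
  intro t
  have hNpos : ∀ j, (0:ℝ) < N j := fun j => by
    have := hbounds j
    exact_mod_cast (by omega : 0 < N j)
  have hinv : Tendsto (fun j => ((N j : ℝ))⁻¹) atTop (𝓝 0) := hN.inv_tendsto_atTop
  set l : ℕ → ℝ := fun j => (k j : ℝ) * ((N j : ℝ) - n j) / ((n j : ℝ) + 1) with hl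
  set ε : ℕ → ℝ := fun j => ((N j : ℝ) - n j + k j) / ((n j : ℝ) + 1) with hε
  set s : ℕ → ℝ := fun j => t / fposSD (k j) (n j) (N j) with hs
  have hεt : Tendsto ε atTop (𝓝 0) := by
    have h := ((tendsto_const_nhds (x := (1:ℝ))).sub hn |>.add hk).div (hn.add hinv) (by norm_num)
    norm_num at h
    refine h.congr fun j => ?_
    have := hNpos j
    simp only [hε, Pi.div_apply]
    field_simp
  have hlt : Tendsto l atTop atTop := by
    refine tendsto_atTop_mono (fun j => ?_) hkN
    obtain ⟨h1, h2, h3⟩ := hbounds j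
    have h4 : (n j : ℝ) + 1 ≤ N j := by exact_mod_cast h3
    simp only [hl]
    refine div_le_div_of_nonneg_left ?_ (by positivity) h4
    exact mul_nonneg (Nat.cast_nonneg _) (by linarith)
  have hρ : Tendsto (fun j => l j / fposVar (k j) (n j) (N j)) atTop (𝓝 1) := by
    have h := ((hn.add hinv).mul (hn.add (hinv.const_mul 2))).div
      (((tendsto_const_nhds (x := (1:ℝ))).add hinv).mul ((hn.sub hk).add hinv)) (by norm_num)
    norm_num at h
    refine h.congr fun j => ?_
    obtain ⟨h1, h2, h3⟩ := hbounds j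
    have h4 := hNpos j
    have h5 : (0:ℝ) < (N j : ℝ) - n j := sub_pos.2 (by exact_mod_cast h3)
    have h6 : (0:ℝ) < (n j : ℝ) - k j + 1 := by
      have : (k j : ℝ) ≤ n j := by exact_mod_cast h2
      linarith
    have h7 : (0:ℝ) < k j := by exact_mod_cast h1
    simp only [hl, fposVar, Pi.div_apply]
    have e1 : (n j : ℝ) / N j + (N j : ℝ)⁻¹ = (n j + 1) / N j := by field_simp
    have e2 : (n j : ℝ) / N j + 2 * (N j : ℝ)⁻¹ = (n j + 2) / N j := by field_simp
    have e3 : 1 + (N j : ℝ)⁻¹ = (N j + 1) / N j := by field_simp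
    have e4 : (n j : ℝ) / N j - k j / N j + (N j : ℝ)⁻¹ = (n j - k j + 1) / N j := by field_simp
    simp only [e1, e2, e3, e4]
    have h8 : (0:ℝ) < (n j : ℝ) + 1 := by positivity
    have h9 : (0:ℝ) < (n j : ℝ) + 2 := by positivity
    have h10 : (0:ℝ) < (N j : ℝ) + 1 := by positivity
    generalize (n j : ℝ) - k j + 1 = q at *
    generalize (N j : ℝ) - n j = p at *
    field_simp
  have hV : ∀ j, 0 ≤ fposVar (k j) (n j) (N j) := by
    intro j
    obtain ⟨h1, h2, h3⟩ := hbounds j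
    have h5 : (0:ℝ) ≤ (N j : ℝ) - n j := sub_nonneg.2 (by exact_mod_cast h3.le)
    have h6 : (0:ℝ) ≤ (n j : ℝ) - k j + 1 := by
      have : (k j : ℝ) ≤ n j := by exact_mod_cast h2
      linarith
    unfold fposVar
    positivity
  have hs2 : ∀ j, s j ^ 2 = t ^ 2 / fposVar (k j) (n j) (N j) := by
    intro j
    simp only [hs, fposSD, div_pow, Real.sq_sqrt (hV j)]
  have hls : Tendsto (fun j => l j * s j ^ 2) atTop (𝓝 (t ^ 2)) := by
    have h := hρ.const_mul (t ^ 2)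
    rw [mul_one] at h
    refine h.congr fun j => ?_
    rw [hs2]; ring
  have hsabs : Tendsto (fun j => |s j|) atTop (𝓝 0) := by
    have h := hls.mul hlt.inv_tendsto_atTop
    rw [mul_zero] at h
    have h' : Tendsto (fun j => s j ^ 2) atTop (𝓝 0) := by
      refine h.congr' ?_
      filter_upwards [hlt.eventually_gt_atTop 0] with j hj
      simp only [Pi.inv_apply]
      field_simp
    have h'' := h'.sqrt
    simpa [Real.sqrt_sq_eq_abs] using h''
  have hev1 : ∀ᶠ j in atTop, |s j| ≤ 1 := hsabs.eventually_le_const (by norm_num)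
  have hev2 : ∀ᶠ j in atTop, 4 * |s j| * ε j ≤ 1 := by
    have h := (hsabs.const_mul 4).mul hεt
    rw [mul_zero] at h
    exact h.eventually_le_const (by norm_num)
  set S : ℕ → ℝ := fun j => ∑ x ∈ Finset.Icc (k j) (N j - n j + k j),
    Real.exp (s j * ((x : ℝ) - fposMean (k j) (n j) (N j))) * fpos (k j) (n j) (N j) x with hS
  have hSS : Tendsto S atTop (𝓝 (Real.exp (t ^ 2 / 2))) := by
    have hB : Tendsto (fun j => l j * s j ^ 2 * (12 * ε j + |s j|)) atTop (𝓝 0) := by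
      have h := hls.mul ((hεt.const_mul 12).add hsabs)
      simpa using h
    have hD : Tendsto (fun j => Real.log (S j) - l j * s j ^ 2 / 2) atTop (𝓝 0) := by
      refine squeeze_zero_norm' ?_ hB
      filter_upwards [hev1, hev2] with j h1 h2
      exact (aux_point (k j) (n j) (N j) (hbounds j).1 (hbounds j).2.1 (hbounds j).2.2 (s j) h1 h2).2
    have hL : Tendsto (fun j => Real.log (S j)) atTop (𝓝 (t ^ 2 / 2)) := by
      have h := hD.add (hls.div_const 2)
      rw [zero_add] at h
      exact h.congr fun j => by ring
    refine ((Real.continuous_exp.tendsto _).comp hL).congr' ?_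
    filter_upwards [hev1, hev2] with j h1 h2
    exact Real.exp_log
      (aux_point (k j) (n j) (N j) (hbounds j).1 (hbounds j).2.1 (hbounds j).2.2 (s j) h1 h2).1
  refine hSS.congr fun j => ?_
  refine Finset.sum_congr rfl fun x _ => ?_
  simp only [hs]
  congr 2
  ring
end

section
/- Let (N_j), (n_j), (k_j) be sequences of integers with 1 ≤ k_j ≤ n_j < N_j for all j, such that N_j → ∞, n_j/N_j → λ and k_j/n_j → φ for fixed constants 0 < λ < 1 and 0 < φ < 1. Then the scaled FPOS random variable X/(N_j + 1) converges in probability to φ: for every ε > 0, Σ_{x : k_j ≤ x ≤ N_j−n_j+k_j and |x/(N_j+1) − φ| ≥ ε} f(x; k_j, n_j, N_j) → 0 as j → ∞. -/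
open Filter Topology
open scoped Classical

theorem fpos_hs (b m : ℕ) : ∑ i ∈ Finset.range (m+1), i.choose b = (m+1).choose (b+1) := by
  induction m with
  | zero => simp [Nat.choose_succ_succ]
  | succ m ih => rw [Finset.sum_range_succ, ih, Nat.choose_succ_succ (m+1) b, add_comm]

theorem fpos_T (a b : ℕ) : ∀ m : ℕ, ∑ i ∈ Finset.range (m+1), i.choose a * (m-i).choose b
    = (m+1).choose (a+b+1) := by
  induction a with
  | zero =>
    intro m

    simp only [Nat.choose_zero_right, one_mul, zero_add]
    have r := Finset.sum_range_reflect (fun i => i.choose b) (m+1)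
    simp only [Nat.add_sub_cancel] at r
    rw [r, fpos_hs]
  | succ a ih =>
    intro m
    induction m with
    | zero => simp; rw [Nat.choose_eq_zero_of_lt (by omega)]
    | succ m ihm =>
      rw [Finset.sum_range_succ']
      simp only [Nat.choose_zero_succ, zero_mul, add_zero, Nat.add_sub_add_right, Nat.choose_succ_succ, add_mul, Finset.sum_add_distrib] at *
      rw [ih]
      simp only [Nat.succ_eq_add_one] at *
      rw [ihm]
      rw [show a + 1 + b + 1 = (a+b+1)+1 by ring, show a + 1 + b = a + b + 1 by ring]
      simp only [Nat.choose_succ_succ, Nat.succ_eq_add_one]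

theorem fpos_M1 (a b m : ℕ) : ∑ i ∈ Finset.range (m+1), (i+1) * (i.choose a * (m-i).choose b)
    = (a+1) * (m+2).choose (a+b+2) := by
  have h := fpos_T (a+1) b (m+1)
  rw [Finset.sum_range_succ'] at h
  simp only [Nat.choose_zero_succ, zero_mul, add_zero, Nat.add_sub_add_right] at h
  rw [show a + b + 2 = a + 1 + b + 1 by ring, show m + 2 = m + 1 + 1 by ring, ← h, Finset.mul_sum]
  refine Finset.sum_congr rfl fun i _ => ?_
  rw [← mul_assoc, Nat.add_one_mul_choose_eq]; ring

theorem fpos_M2 (a b m : ℕ) :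
    ∑ i ∈ Finset.range (m+1), (i+1) * (i+2) * (i.choose a * (m-i).choose b)
    = (a+1) * (a+2) * (m+3).choose (a+b+3) := by
  have h := fpos_M1 (a+1) b (m+1)
  rw [Finset.sum_range_succ'] at h
  simp only [Nat.choose_zero_succ, zero_mul, mul_zero, add_zero, Nat.add_sub_add_right] at h
  rw [show a + b + 3 = a + 1 + b + 2 by ring, show m + 3 = m + 1 + 2 by ring,
    mul_assoc, show a + 2 = a + 1 + 1 by ring, ← h, Finset.mul_sum]
  refine Finset.sum_congr rfl fun i _ => ?_
  have := Nat.add_one_mul_choose_eq i a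
  calc _ = (i+2) * ((i+1) * i.choose a) * (m-i).choose b := by ring
    _ = _ := by rw [this]; ring

theorem fpos_var (k n N : ℕ) (h1 : 1 ≤ k) (h2 : k ≤ n) (h3 : n < N) (p : ℝ) :
    ∑ x ∈ Finset.Icc 1 N, ((x:ℝ) / (N+1) - p)^2 * fpos k n N x
     = k/(n+1) * ((k+1)/(n+2)) * ((N+2)/(N+1)) - (2*p + 1/(N+1)) * (k/(n+1)) + p^2 := by
  obtain ⟨a, rfl⟩ : ∃ a, k = a + 1 := ⟨k-1, by omega⟩
  obtain ⟨b, rfl⟩ : ∃ b, n = a + 1 + b := ⟨n-(a+1), by omega⟩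
  obtain ⟨m, rfl⟩ : ∃ m, N = m + 1 := ⟨N-1, by omega⟩
  have e : Finset.Icc 1 (m+1) = (Finset.range (m+1)).image (· + 1) := by
    ext x; simp only [Finset.mem_Icc, Finset.mem_image, Finset.mem_range]
    constructor
    · intro h; exact ⟨x-1, by omega, by omega⟩
    · rintro ⟨y, h, rfl⟩; omega
  rw [e, Finset.sum_image (by intro x _ y _ h; simpa using h)]
  have t0 := congrArg (Nat.cast (R := ℝ)) (fpos_T a b m)
  have t1 := congrArg (Nat.cast (R := ℝ)) (fpos_M1 a b m)
  have t2 := congrArg (Nat.cast (R := ℝ)) (fpos_M2 a b m)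
  have c1 := congrArg (Nat.cast (R := ℝ)) (Nat.add_one_mul_choose_eq (m+1) (a+b+1))
  have c2 := congrArg (Nat.cast (R := ℝ)) (Nat.add_one_mul_choose_eq (m+2) (a+b+2))
  have hC : (((m+1).choose (a+b+1) : ℕ) : ℝ) ≠ 0 := by
    exact_mod_cast (Nat.choose_pos (by omega)).ne'
  push_cast at t0 t1 t2 c1 c2
  simp only [fpos, Nat.add_sub_cancel, Nat.add_sub_add_right, Nat.add_sub_cancel_left]
  rw [show a + 1 + b = a + b + 1 by ring]
  set C := (((m+1).choose (a+b+1) : ℕ) : ℝ)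
  have key : ∑ x ∈ Finset.range (m+1), ((((x+1:ℕ):ℝ) / (((m+1:ℕ):ℝ)+1) - p)^2 * (((x.choose a * (m-x).choose b : ℕ):ℝ) / C))
     = ((1/((m:ℝ)+2)^2) * ∑ i ∈ Finset.range (m+1), ((i:ℝ)+1) * (i+2) * (i.choose a * (m-i).choose b)
       - (1/((m:ℝ)+2)^2 + 2*p/(m+2)) * ∑ i ∈ Finset.range (m+1), ((i:ℝ)+1) * (i.choose a * (m-i).choose b)
       + p^2 * ∑ i ∈ Finset.range (m+1), ((i.choose a:ℝ) * (m-i).choose b)) / C := by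
    simp only [Finset.mul_sum]
    rw [← Finset.sum_sub_distrib, ← Finset.sum_add_distrib, Finset.sum_div]
    refine Finset.sum_congr rfl fun i _ => ?_
    push_cast
    rw [show (m:ℝ)+1+1 = m + 2 by ring]
    have : (m:ℝ)+2 ≠ 0 := by positivity
    field_simp
    ring
  rw [key, t0, t1, t2]
  have d1 : (((m+2).choose (a+b+2) : ℕ) : ℝ) = (m+2) * C / (a+b+2) := by
    rw [eq_div_iff (by positivity)]; linarith
  have d2 : (((m+3).choose (a+b+3) : ℕ) : ℝ) = (m+3) * ((m+2) * C / (a+b+2)) / (a+b+3) := by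
    rw [eq_div_iff (by positivity), ← d1]; linarith
  rw [d1, d2]
  push_cast
  rw [show (m:ℝ)+1+1 = m + 2 by ring, show (m:ℝ)+1+2 = m + 3 by ring,
    show (a:ℝ)+b+1+1 = a+b+2 by ring, show (a:ℝ)+b+1+2 = a+b+3 by ring,
    show (a:ℝ)+1+1 = a + 2 by ring]
  have : (m:ℝ)+2 ≠ 0 := by positivity
  have : (a:ℝ)+b+2 ≠ 0 := by positivity
  have : (a:ℝ)+b+3 ≠ 0 := by positivity
  field_simp
  ring

/-- Along any limit path N_j → ∞, n_j/N_j → λ, k_j/n_j → φ with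
0 < λ < 1 and 0 < φ < 1, the scaled FPOS random variable X/(N_j + 1) converges in
probability to φ: for every ε > 0,
Σ_{x : k_j ≤ x ≤ N_j−n_j+k_j, |x/(N_j+1) − φ| ≥ ε} f(x; k_j, n_j, N_j) → 0. -/
theorem fpos_convergence_in_probability (N n k : ℕ → ℕ)
    (hbounds : ∀ j, 1 ≤ k j ∧ k j ≤ n j ∧ n j < N j)
    (lam phi : ℝ) (hlam0 : 0 < lam) (hlam1 : lam < 1) (hphi0 : 0 < phi) (hphi1 : phi < 1)
    (hN : Tendsto (fun j => (N j : ℝ)) atTop atTop)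
    (hn : Tendsto (fun j => (n j : ℝ) / (N j : ℝ)) atTop (𝓝 lam))
    (hk : Tendsto (fun j => (k j : ℝ) / (n j : ℝ)) atTop (𝓝 phi)) :
    ∀ ε : ℝ, 0 < ε →
      Tendsto (fun j =>
          ∑ x ∈ (Finset.Icc (k j) (N j - n j + k j)).filter
              (fun x : ℕ => ε ≤ |(x : ℝ) / ((N j : ℝ) + 1) - phi|),
            fpos (k j) (n j) (N j) x)
        atTop (𝓝 0) := by
  intro ε hε
  have f0 : ∀ k n N x, 0 ≤ fpos k n N x := fun k n N x => by unfold fpos; positivity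
  have hn' : Tendsto (fun j => (n j : ℝ)) atTop atTop := by
    refine (hn.pos_mul_atTop hlam0 hN).congr fun j => ?_
    have : (N j : ℝ) ≠ 0 := by have := hbounds j; norm_cast; omega
    field_simp
  have i1 : Tendsto (fun j => ((n j : ℝ))⁻¹) atTop (𝓝 0) := tendsto_inv_atTop_zero.comp hn'
  have iN : Tendsto (fun j => ((N j : ℝ))⁻¹) atTop (𝓝 0) := tendsto_inv_atTop_zero.comp hN
  have iN1 : Tendsto (fun j => 1 / ((N j : ℝ) + 1)) atTop (𝓝 0) := by
    simpa [Function.comp_def] using tendsto_inv_atTop_zero.comp (tendsto_atTop_add_const_right _ (1:ℝ) hN)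
  have hnpos : ∀ j, (0:ℝ) < n j := fun j => by have := hbounds j; norm_cast; omega
  have A : Tendsto (fun j => (k j : ℝ) / (n j + 1)) atTop (𝓝 phi) := by
    have := hk.div (i1.const_add 1) (by norm_num)
    simp only [add_zero, div_one] at this
    refine this.congr fun j => ?_
    have := hnpos j
    simp only [Pi.div_apply]
    field_simp
  have B : Tendsto (fun j => ((k j : ℝ) + 1) / (n j + 2)) atTop (𝓝 phi) := by
    have := (hk.add i1).div ((i1.const_mul 2).const_add 1) (by norm_num)
    simp only [add_zero, mul_zero, div_one] at this
    refine this.congr fun j => ?_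
    have := hnpos j
    simp only [Pi.div_apply]
    field_simp
  have D : Tendsto (fun j => ((N j : ℝ) + 2) / (N j + 1)) atTop (𝓝 1) := by
    have := iN1.const_add 1
    simp only [add_zero] at this
    refine this.congr fun j => ?_
    field_simp
    ring
  have V := ((((A.mul B).mul D).sub ((iN1.const_add (2*phi)).mul A)).add_const (phi^2)).const_mul (1/ε^2)
  rw [show 1/ε^2 * (phi * phi * 1 - (2*phi+0)*phi + phi^2) = 0 by ring] at V
  refine squeeze_zero (fun j => Finset.sum_nonneg fun x _ => f0 _ _ _ _) (fun j => ?_) V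
  obtain ⟨h1, h2, h3⟩ := hbounds j
  rw [← fpos_var (k j) (n j) (N j) h1 h2 h3 phi, Finset.mul_sum]
  refine (Finset.sum_le_sum (g := fun x : ℕ => 1/ε^2 * (((x:ℝ) / (N j+1) - phi)^2 * fpos (k j) (n j) (N j) x)) fun x hx => ?_).trans (Finset.sum_le_sum_of_subset_of_nonneg ?_ fun x _ _ => ?_)
  · have hx := (Finset.mem_filter.1 hx).2
    have : ε^2 ≤ ((x:ℝ) / (N j+1) - phi)^2 := by
      rw [← sq_abs ((x:ℝ) / (N j+1) - phi)]; gcongr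
    rw [← mul_assoc]
    refine le_mul_of_one_le_left (f0 _ _ _ _) ?_
    rw [one_div_mul_eq_div, one_le_div (by positivity)]; exact this
  · intro x hx
    have hx := Finset.mem_Icc.1 (Finset.mem_filter.1 hx).1
    exact Finset.mem_Icc.2 ⟨by omega, by omega⟩
  · have := f0 (k j) (n j) (N j) x
    positivity
end

section
/- Fix integers 1 ≤ k ≤ n and let g : ℕ → ℝ. If for every integer N ≥ n the expectation of g under the FPOS distribution vanishes, i.e., Σ_{x=k}^{N−n+k} g(x)·C(x−1, k−1)·C(N−x, n−k)/C(N, n) = 0 for all N ≥ n, then g(x) = 0 for all integers x ≥ k. (This establishes that the top observed order statistic is a complete statistic for the population size N.) -/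
/-- Fix integers 1 ≤ k ≤ n and let g : ℕ → ℝ. If for every integer N ≥ n
the expectation of g under the FPOS distribution vanishes, then g(x) = 0 for all x ≥ k.
(Completeness of the top observed order statistic for N.) -/
theorem fpos_complete (k n : ℕ) (hk : 1 ≤ k) (hkn : k ≤ n) (g : ℕ → ℝ)
    (h : ∀ N : ℕ, n ≤ N → ∑ x ∈ Finset.Icc k (N - n + k), g x * fpos k n N x = 0) :
    ∀ x : ℕ, k ≤ x → g x = 0 := by
  intro x
  induction x using Nat.strong_induction_on with
  | _ x ih =>
    intro hx
    have h1 := h (x - k + n) (by omega)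
    have e : x - k + n - n + k = x := by omega
    rw [e, Finset.sum_eq_single x] at h1
    · have hp : fpos k n (x - k + n) x ≠ 0 := by
        unfold fpos
        have a1 : 0 < (x - 1).choose (k - 1) := Nat.choose_pos (by omega)
        have a2 : 0 < (x - k + n - x).choose (n - k) := Nat.choose_pos (by omega)
        have a3 : 0 < (x - k + n).choose n := Nat.choose_pos (by omega)
        exact div_ne_zero (Nat.cast_ne_zero.mpr (Nat.mul_pos a1 a2).ne')
          (Nat.cast_ne_zero.mpr a3.ne')
      exact (mul_eq_zero.mp h1).resolve_right hp
    · intro b hb hbx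
      rw [Finset.mem_Icc] at hb
      rw [ih b (by omega) hb.1, zero_mul]
    · intro hn
      exact absurd (Finset.mem_Icc.mpr ⟨hx, le_refl x⟩) hn
end

section
/- Fix integers 1 ≤ k ≤ n and let g : ℕ → ℝ. Define G(N) = Σ_{x=k}^{N−n+k} g(x)·(N−x)!·(x−1)! / ((N−n−x+k)!·(x−k)!) for integers N ≥ n. If G(N) = 0 for all integers N ≥ n, then g(x) = 0 for all integers x ≥ k. -/
/-- Fix integers 1 ≤ k ≤ n and let g : ℕ → ℝ. Define
G(N) = Σ_{x=k}^{N−n+k} g(x)·(N−x)!·(x−1)! / ((N−n−x+k)!·(x−k)!) for N ≥ n.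
If G(N) = 0 for all integers N ≥ n, then g(x) = 0 for all integers x ≥ k. -/
theorem fpos_completeness_lemma (k n : ℕ) (hk : 1 ≤ k) (hkn : k ≤ n) (g : ℕ → ℝ)
    (h : ∀ N : ℕ, n ≤ N →
      ∑ x ∈ Finset.Icc k (N - n + k),
        g x * ((Nat.factorial (N - x) : ℝ) * (Nat.factorial (x - 1) : ℝ)) /
          ((Nat.factorial (N - n + k - x) : ℝ) * (Nat.factorial (x - k) : ℝ)) = 0) :
    ∀ x : ℕ, k ≤ x → g x = 0 := by
  intro x
  induction x using Nat.strong_induction_on with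
  | _ x ih =>
    intro hx
    have h1 := h (x + n - k) (by omega)
    have e : x + n - k - n + k = x := by omega
    rw [e, Finset.sum_eq_single_of_mem x (Finset.mem_Icc.mpr ⟨hx, le_refl x⟩)] at h1
    · have a1 := Nat.factorial_ne_zero (x + n - k - x)
      have a2 := Nat.factorial_ne_zero (x - 1)
      have a3 := Nat.factorial_ne_zero (x - x)
      have a4 := Nat.factorial_ne_zero (x - k)
      rw [div_eq_zero_iff, mul_eq_zero, mul_eq_zero, mul_eq_zero] at h1
      simp only [Nat.cast_eq_zero, a1, a2, a3, a4, or_false] at h1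
      exact h1
    · intro b hb hne
      rw [Finset.mem_Icc] at hb
      rw [ih b (by omega) hb.1]
      simp
end

section
/- For all integers 1 ≤ k ≤ n ≤ N, the generalized German tank estimator N̂_k = ((n+1)/k)·X_{(k)} − 1 based on the k-th order statistic is an unbiased estimator of the population size N with variance (N+1)(N−n)(n−k+1)/((n+2)k); that is, Σ_{x=k}^{N−n+k} ( ((n+1)/k)·x − 1 )·f(x; k, n, N) = N and Σ_{x=k}^{N−n+k} ( ((n+1)/k)·x − 1 − N )²·f(x; k, n, N) = (N+1)(N−n)(n−k+1)/((n+2)k). -/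
lemma vdm (a b m : ℕ) :
    ∑ j ∈ Finset.range (m + 1), (((a + j).choose a : ℝ) * ((b + (m - j)).choose b : ℝ)) =
      ((a + b + 1 + m).choose (a + b + 1) : ℝ) := by
  have h1 := PowerSeries.mk_one_pow_eq_mk_choose_add (S := ℝ) a
  have h2 := PowerSeries.mk_one_pow_eq_mk_choose_add (S := ℝ) b
  have h3 := PowerSeries.mk_one_pow_eq_mk_choose_add (S := ℝ) (a + b + 1)
  have h4 : (PowerSeries.mk 1 : PowerSeries ℝ) ^ (a + b + 1 + 1) =
      (PowerSeries.mk 1 : PowerSeries ℝ) ^ (a + 1) * (PowerSeries.mk 1 : PowerSeries ℝ) ^ (b + 1) := by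
    ring
  rw [h1, h2, h3] at h4
  have h5 := congrArg (PowerSeries.coeff m) h4
  rw [PowerSeries.coeff_mul, PowerSeries.coeff_mk,
    Finset.Nat.sum_antidiagonal_eq_sum_range_succ_mk] at h5
  simp only [PowerSeries.coeff_mk] at h5
  exact h5.symm

theorem german_tank_estimator (k n N : ℕ) (hk : 1 ≤ k) (hkn : k ≤ n) (hnN : n ≤ N) :
    (∑ x ∈ Finset.Icc k (N - n + k),
        (((n : ℝ) + 1) / (k : ℝ) * (x : ℝ) - 1) * fpos k n N x = (N : ℝ)) ∧
    (∑ x ∈ Finset.Icc k (N - n + k),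
        (((n : ℝ) + 1) / (k : ℝ) * (x : ℝ) - 1 - (N : ℝ)) ^ 2 * fpos k n N x =
      ((N : ℝ) + 1) * ((N : ℝ) - (n : ℝ)) * ((n : ℝ) - (k : ℝ) + 1) /
        (((n : ℝ) + 2) * (k : ℝ))) := by
  obtain ⟨a, rfl⟩ := Nat.exists_eq_add_of_le hk
  obtain ⟨b, rfl⟩ := Nat.exists_eq_add_of_le hkn
  obtain ⟨m, rfl⟩ := Nat.exists_eq_add_of_le hnN
  set k := 1 + a with hkd
  set n := k + b with hnd
  set N := n + m with hNd
  have hC : (0 : ℝ) < (N.choose n : ℝ) := by exact_mod_cast Nat.choose_pos hnN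
  have hre : ∀ g : ℝ → ℝ, ∑ x ∈ Finset.Icc k (N - n + k), g x * fpos k n N x =
      (∑ j ∈ Finset.range (m + 1), g (a + j + 1) *
        (((a + j).choose a : ℝ) * ((b + (m - j)).choose b : ℝ))) / (N.choose n : ℝ) := by
    intro g
    have : Finset.Icc k (N - n + k) = Finset.Ico k (k + (m + 1)) := by
      ext x; simp only [Finset.mem_Icc, Finset.mem_Ico]; omega
    rw [this, Finset.sum_Ico_eq_sum_range, Finset.sum_div]
    apply Finset.sum_congr (by congr 1; omega)
    intro j hj
    have hj' := Finset.mem_range.1 hj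
    unfold fpos
    have e1 : k + j - 1 = a + j := by omega
    have e2 : k - 1 = a := by omega
    have e3 : N - (k + j) = b + (m - j) := by omega
    have e4 : n - k = b := by omega
    have e5 : ((k + j : ℕ) : ℝ) = a + j + 1 := by rw [hkd]; push_cast; ring
    rw [e1, e2, e3, e4, e5]
    push_cast
    ring
  have q1 : ∀ c j : ℕ, ((c : ℝ) + j + 1) * ((c + j).choose c : ℝ) =
      (c + 1) * ((c + 1 + j).choose (c + 1) : ℝ) := by
    intro c j
    have := Nat.add_one_mul_choose_eq (c + j) c
    rw [show c + j + 1 = c + 1 + j by ring] at this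
    have h : (((c + 1 + j) * (c + j).choose c : ℕ) : ℝ) =
      (((c + 1 + j).choose (c + 1) * (c + 1) : ℕ) : ℝ) := by exact_mod_cast this
    push_cast at h
    linarith
  have s0 := vdm a b m
  have s1 := vdm (a + 1) b m
  have s2 := vdm (a + 1 + 1) b m
  have r1 := q1 n m
  have r2 := q1 (n + 1) m
  rw [show a + b + 1 = n by omega] at s0
  rw [show a + 1 + b + 1 = n + 1 by omega] at s1
  rw [show a + 1 + 1 + b + 1 = n + 1 + 1 by omega] at s2
  have key : ∀ u v w : ℝ, ∑ j ∈ Finset.range (m + 1),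
      (u * ((a + j + 1 : ℝ) * (a + j + 1 + 1)) + v * (a + j + 1) + w) *
        (((a + j).choose a : ℝ) * ((b + (m - j)).choose b : ℝ)) =
      u * ((a + 1) * (a + 2) * ((n + 1 + 1 + m).choose (n + 1 + 1) : ℝ))
      + v * ((a + 1) * ((n + 1 + m).choose (n + 1) : ℝ)) + w * ((n + m).choose n : ℝ) := by
    intro u v w
    rw [← s0, ← s1, ← s2]
    simp only [Finset.mul_sum, ← Finset.sum_add_distrib]
    apply Finset.sum_congr rfl
    intro j _
    have t1 := q1 a j
    have t2 := q1 (a + 1) j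
    push_cast at t2
    linear_combination ((b + (m - j)).choose b : ℝ) * ((u * (a + j + 1 + 1) + v) * t1
      + u * (a + 1) * t2)
  have hkR : (k : ℝ) = a + 1 := by rw [hkd]; push_cast; ring
  have hnR : (n : ℝ) = a + 1 + b := by rw [hnd]; push_cast; rw [hkR]
  have hNR : (N : ℝ) = n + m := by rw [hNd]; push_cast; rfl
  have ha : (0 : ℝ) < a + 1 := by positivity
  have hn1 : (0 : ℝ) < n + 1 := by positivity
  have hn2 : (0 : ℝ) < n + 2 := by positivity
  push_cast at r2
  have R1 : ((n + 1 + m).choose (n + 1) : ℝ) = (N + 1) / (n + 1) * (N.choose n : ℝ) := by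
    rw [hNR]; field_simp; linarith
  have R2 : ((n + 1 + 1 + m).choose (n + 1 + 1) : ℝ) =
      (N + 2) / (n + 2) * ((N + 1) / (n + 1) * (N.choose n : ℝ)) := by
    rw [← R1, hNR]; field_simp; linarith
  rw [R1, R2, ← hNd] at key
  constructor
  · rw [hre (fun x => ((n : ℝ) + 1) / (k : ℝ) * x - 1)]
    have := key 0 (((n : ℝ) + 1) / (k : ℝ)) (-1)
    rw [div_eq_iff hC.ne']
    refine (Finset.sum_congr rfl fun j _ => ?_).trans (this.trans ?_)
    · ring
    · rw [hkR]; field_simp; ring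
  · rw [hre (fun x => (((n : ℝ) + 1) / (k : ℝ) * x - 1 - N) ^ 2)]
    have := key ((((n : ℝ) + 1) / (k : ℝ)) ^ 2)
      (-(((n : ℝ) + 1) / (k : ℝ)) ^ 2 - 2 * (((n : ℝ) + 1) / (k : ℝ)) * (1 + N)) ((1 + N) ^ 2)
    rw [div_eq_iff hC.ne']
    refine (Finset.sum_congr rfl fun j _ => ?_).trans (this.trans ?_)
    · ring
    · rw [hkR]; field_simp; ring
end
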